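/- arXiv:2012.11037 — 7 statements merged into one kernel-verified Lean document; each statement's English description precedes it below -/
import Mathlib

section
/- Let n ≥ 2. There is a group isomorphism Φ : BS(1,n) → ℤ[1/n] ⋊_f ℤ determined by Φ(a) = (1, 0) and Φ(t) = (0, −1); on normal forms it is given by Φ(t^i·a^j·t^{−k}) = (j·n^{−i}, k − i). -/
/-- Generators of the Baumslag–Solitar group. -/
inductive BSgen : Type
  | a : BSgen
  | t : BSgen

/-- The single relator `t⁻¹·a·t·(aⁿ)⁻¹` of `BS(1,n)`. -/
def BSrel (n : ℕ) : Set (FreeGroup BSgen) :=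
  {(FreeGroup.of BSgen.t)⁻¹ * FreeGroup.of BSgen.a * FreeGroup.of BSgen.t *
      ((FreeGroup.of BSgen.a) ^ n)⁻¹}

/-- The Baumslag–Solitar group `BS(1,n) = ⟨a, t ∣ t⁻¹·a·t = aⁿ⟩`. -/
abbrev BS (n : ℕ) : Type := PresentedGroup (BSrel n)

/-- The generator `a` of `BS(1,n)`. -/
def BSa (n : ℕ) : BS n := PresentedGroup.of BSgen.a

/-- The generator `t` of `BS(1,n)`. -/
def BSt (n : ℕ) : BS n := PresentedGroup.of BSgen.t

/-- The set `ℤ[1/n] ⊆ ℚ` of rationals of the form `j/nⁱ` with `j ∈ ℤ`, `i ∈ ℕ`. -/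
def ZinvN (n : ℕ) : Set ℚ := {q | ∃ (j : ℤ) (i : ℕ), q * (n : ℚ) ^ i = (j : ℚ)}

/-- The defining relation of `BS(1,n)`, in the form `t·aⁿ = a·t`. -/
theorem BS_semiconjBy (n : ℕ) : SemiconjBy (BSt n) (BSa n ^ n) (BSa n) := by
  have h : (BSt n)⁻¹ * BSa n * BSt n * (BSa n ^ n)⁻¹ = 1 :=
    PresentedGroup.one_of_mem (rels := BSrel n) rfl
  rw [SemiconjBy, ← mul_inv_eq_one.1 h]
  group

theorem BS_pow_semiconjBy (n i : ℕ) :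
    SemiconjBy (BSt n ^ i) (BSa n ^ (n ^ i)) (BSa n) := by
  induction i with
  | zero => simp
  | succ i ih =>
    rw [pow_succ' (BSt n), pow_succ n, pow_mul]
    exact (BS_semiconjBy n).mul_left (ih.pow_right n)

theorem BS_zpow_mul_pow (n i : ℕ) (j : ℤ) :
    BSa n ^ j * BSt n ^ i = BSt n ^ i * BSa n ^ ((n : ℤ) ^ i * j) := by
  have h := (BS_pow_semiconjBy n i).zpow_right j
  rw [SemiconjBy, ← zpow_natCast (BSa n), ← zpow_mul] at h
  rw [← h]
  push_cast
  rfl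

/-- Left multiplication by a power of `a` preserves normal forms. -/
theorem BS_zpow_mul_normalForm (n i k : ℕ) (j l : ℤ) :
    BSa n ^ l * (BSt n ^ i * BSa n ^ j * BSt n ^ (-(k : ℤ))) =
      BSt n ^ i * BSa n ^ ((n : ℤ) ^ i * l + j) * BSt n ^ (-(k : ℤ)) := by
  rw [zpow_add, ← mul_assoc, ← mul_assoc, BS_zpow_mul_pow]
  simp only [mul_assoc]

/-- Every element of `BS(1,n)` has a normal form `tⁱ·aʲ·t⁻ᵏ`. -/
theorem BS_exists_normalForm (n : ℕ) (g : BS n) :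
    ∃ (i : ℕ) (j : ℤ) (k : ℕ), g = BSt n ^ i * BSa n ^ j * BSt n ^ (-(k : ℤ)) := by
  have hg : g ∈ Subgroup.closure (Set.range (PresentedGroup.of (rels := BSrel n))) := by
    rw [PresentedGroup.closure_range_of]
    trivial
  induction hg using Subgroup.closure_induction_left with
  | one => exact ⟨0, 0, 0, by simp⟩
  | mul_left x hx y _ ih =>
    obtain ⟨i, j, k, rfl⟩ := ih
    obtain ⟨_ | _, rfl⟩ := hx
    · exact ⟨i, _, k, by rw [← BS_zpow_mul_normalForm n i k j 1, zpow_one]; rfl⟩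
    · exact ⟨i + 1, j, k, by rw [pow_succ']; simp only [mul_assoc]; rfl⟩
  | inv_mul_cancel x hx y _ ih =>
    obtain ⟨i, j, k, rfl⟩ := ih
    obtain ⟨_ | _, rfl⟩ := hx
    · exact ⟨i, _, k, by rw [← BS_zpow_mul_normalForm n i k j (-1), zpow_neg_one]; rfl⟩
    · change ∃ i' j' k', (BSt n)⁻¹ * _ = _
      cases i with
      | zero =>
        refine ⟨0, n * j, k + 1, ?_⟩
        have h := BS_zpow_mul_pow n 1 j
        rw [pow_one, pow_one] at h
        rw [inv_mul_eq_iff_eq_mul, pow_zero, one_mul, one_mul, ← mul_assoc, ← h]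
        push_cast
        group
      | succ i =>
        exact ⟨i, j, k, by rw [pow_succ']; simp only [mul_assoc, inv_mul_cancel_left]⟩

/-- The action of `ℤ` on the additive group `ℚ` in which `1` acts as multiplication by `u`. -/
def dilationAction (u : ℚˣ) : Multiplicative ℤ →* MulAut (Multiplicative ℚ) :=
  (MulAutMultiplicative ℚ).symm.toMonoidHom.comp (AddAut.mulLeft.comp (zpowersHom ℚˣ u))

theorem toAdd_dilationAction (u : ℚˣ) (k : Multiplicative ℤ) (x : Multiplicative ℚ) :
    (dilationAction u k x).toAdd = (u : ℚ) ^ k.toAdd * x.toAdd := by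
  rw [← Units.val_zpow_eq_zpow_val]
  rfl

open Multiplicative in
/-- There is a homomorphism `BS(1,n) → ℚ ⋊ ℤ` with `a ↦ (1,0)` and `t ↦ (0,-1)`. -/
theorem BS_exists_hom (n : ℕ) (u : ℚˣ) (hu : (u : ℚ) = n) :
    ∃ F : BS n →* Multiplicative ℚ ⋊[dilationAction u] Multiplicative ℤ,
      F (BSa n) = SemidirectProduct.inl (ofAdd 1) ∧
      F (BSt n) = SemidirectProduct.inr (ofAdd (-1)) := by
  let f : BSgen → Multiplicative ℚ ⋊[dilationAction u] Multiplicative ℤ := fun x =>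
    match x with
    | .a => SemidirectProduct.inl (ofAdd 1)
    | .t => SemidirectProduct.inr (ofAdd (-1))
  have hf : ∀ r ∈ BSrel n, FreeGroup.lift f r = 1 := by
    rintro _ rfl
    have h := SemidirectProduct.inl_aut (φ := dilationAction u) (ofAdd 1) (ofAdd 1)
    have hpow : dilationAction u (ofAdd 1) (ofAdd 1) = ofAdd (1 : ℚ) ^ n := by
      apply toAdd.injective
      rw [toAdd_dilationAction]
      simp [hu]
    simp only [map_mul, map_inv, map_pow, FreeGroup.lift_apply_of, f]
    rw [mul_inv_eq_one, ← map_pow, ← hpow, h, ← map_inv]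
    rfl
  exact ⟨PresentedGroup.toGroup hf, PresentedGroup.toGroup.of hf, PresentedGroup.toGroup.of hf⟩

/-- For `n ≥ 2` there is a group isomorphism `Φ : BS(1,n) → ℤ[1/n] ⋊_f ℤ`
(the target carrying the law `(h₁,k₁)·(h₂,k₂) = (h₁ + n^{k₁}·h₂, k₁+k₂)`),
determined by `Φ(a) = (1,0)` and `Φ(t) = (0,−1)`; on normal forms it is
`Φ(tⁱ·aʲ·t⁻ᵏ) = (j·n⁻ⁱ, k−i)`. -/
theorem bs_iso_semidirect (n : ℕ) (hn : 2 ≤ n) :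
    ∃ Φ : BS n → ℚ × ℤ,
      Function.Injective Φ ∧
      Set.range Φ = {p : ℚ × ℤ | p.1 ∈ ZinvN n} ∧
      (∀ g h : BS n,
        Φ (g * h) = ((Φ g).1 + (n : ℚ) ^ (Φ g).2 * (Φ h).1, (Φ g).2 + (Φ h).2)) ∧
      Φ (BSa n) = (1, 0) ∧ Φ (BSt n) = (0, -1) ∧
      (∀ (i : ℕ) (j : ℤ) (k : ℕ),
        Φ (BSt n ^ i * BSa n ^ j * BSt n ^ (-(k : ℤ))) = ((j : ℚ) / (n : ℚ) ^ i, (k : ℤ) - (i : ℤ))) := by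
  have hn0 : (n : ℚ) ≠ 0 := by positivity
  let u : ℚˣ := Units.mk0 n hn0
  obtain ⟨F, hFa, hFt⟩ := BS_exists_hom n u rfl
  have hnf : ∀ (i : ℕ) (j : ℤ) (k : ℕ),
      ((F (BSt n ^ i * BSa n ^ j * BSt n ^ (-(k : ℤ)))).left.toAdd,
        (F (BSt n ^ i * BSa n ^ j * BSt n ^ (-(k : ℤ)))).right.toAdd) =
      ((j : ℚ) / (n : ℚ) ^ i, (k : ℤ) - (i : ℤ)) := by
    intro i j k
    rw [map_mul, map_mul, map_pow, map_zpow, map_zpow, hFa, hFt,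
      ← map_pow SemidirectProduct.inr, ← map_zpow SemidirectProduct.inl,
      ← map_zpow SemidirectProduct.inr]
    simp only [SemidirectProduct.mul_left, SemidirectProduct.mul_right,
      SemidirectProduct.left_inl, SemidirectProduct.right_inl, SemidirectProduct.left_inr,
      SemidirectProduct.right_inr, map_one, mul_one, one_mul, toAdd_dilationAction,
      toAdd_mul, toAdd_pow, toAdd_zpow, toAdd_ofAdd]
    ext
    · simp [u, div_eq_inv_mul]
    · simp
      ring
  refine ⟨fun g => ((F g).left.toAdd, (F g).right.toAdd), ?_, ?_, ?_, ?_, ?_, hnf⟩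
  · have hF : Function.Injective F := by
      rw [injective_iff_map_eq_one]
      intro g hg
      obtain ⟨i, j, k, rfl⟩ := BS_exists_normalForm n g
      have h := hnf i j k
      simp only [hg, SemidirectProduct.one_left, SemidirectProduct.one_right, toAdd_one,
        Prod.mk.injEq] at h
      obtain ⟨h₁, h₂⟩ := h
      have hj : j = 0 := by simpa [hn0] using h₁.symm
      have hk : k = i := by omega
      simp [hj, hk]
    intro g h hgh
    simp only [Prod.mk.injEq, EmbeddingLike.apply_eq_iff_eq] at hgh
    exact hF (SemidirectProduct.ext hgh.1 hgh.2)
  · ext ⟨q, m⟩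
    constructor
    · rintro ⟨g, hg⟩
      obtain ⟨i, j, k, rfl⟩ := BS_exists_normalForm n g
      obtain ⟨rfl, -⟩ := Prod.mk.inj ((hnf i j k).symm.trans hg)
      exact ⟨j, i, by field_simp⟩
    · rintro ⟨j, i, hq⟩
      refine ⟨BSt n ^ (i + m.natAbs) * BSa n ^ (j * (n : ℤ) ^ m.natAbs) *
        BSt n ^ (-((m + (i + m.natAbs)).toNat : ℤ)), (hnf _ _ _).trans ?_⟩
      ext
      · simp only at hq ⊢
        push_cast
        rw [← hq, pow_add]
        field_simp
      · simp only
        omega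
  · intro g h
    simp [toAdd_dilationAction, u]
  · simp [hFa]
  · simp [hFt]
end

section
/- For all integers k ≥ 0 and ℓ ≥ 1, the map (i,j) ↦ t^ℓ·a^i·t^{−j} from {0, …, (k+1)·2^{ℓ−1} − 1} × {0, …, ℓ} into BS(1,2) is injective; consequently the rectangle R_{k,ℓ} has cardinality (ℓ+1)·(k+1)·2^{ℓ−1}. -/
/-- The rectangle `R_{k,ℓ} = { tˡ·aⁱ·t⁻ʲ : 0 ≤ i < (k+1)·2^{ℓ−1}, 0 ≤ j ≤ ℓ }` in `BS(1,2)`. -/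
def Rset (k l : ℕ) : Set (BS 2) :=
  {g | ∃ i j : ℕ, i < (k + 1) * 2 ^ (l - 1) ∧ j ≤ l ∧
    g = BSt 2 ^ l * BSa 2 ^ i * BSt 2 ^ (-(j : ℤ))}

/-- The language of size `(k,ℓ)` of `X`: patterns with support `R_{k,ℓ}` appearing in
some configuration of `X`. -/
def Lang {R : Type} (X : Set (BS 2 → R)) (k l : ℕ) : Set (↥(Rset k l) → R) :=
  {p | ∃ x ∈ X, ∃ g : BS 2, ∀ h : Rset k l, x (g * (h : BS 2)) = p h}

/-- The topological entropy of a subshift `X ⊆ R^{BS(1,2)}`, as the `limsup` over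
`(k,ℓ) → ∞` of `log #L_{k,ℓ}(X) / #R_{k,ℓ}`. -/
noncomputable def entropy {R : Type} (X : Set (BS 2 → R)) : ℝ :=
  Filter.limsup
    (fun kl : ℕ × ℕ =>
      Real.log (Nat.card (Lang X kl.1 kl.2)) / (Nat.card (Rset kl.1 kl.2) : ℝ))
    Filter.atTop

/-- The exponent-sum homomorphism of `BS(1,n)` with respect to `t`. -/
def BS.tExponent (n : ℕ) : BS n →* Multiplicative ℤ :=
  PresentedGroup.toGroup
    (f := fun | BSgen.a => 1 | BSgen.t => Multiplicative.ofAdd 1) <| by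
      rintro r rfl
      simp

@[simp]
theorem BS.tExponent_a (n : ℕ) : BS.tExponent n (BSa n) = 1 :=
  PresentedGroup.toGroup.of _

@[simp]
theorem BS.tExponent_t (n : ℕ) : BS.tExponent n (BSt n) = Multiplicative.ofAdd 1 :=
  PresentedGroup.toGroup.of _

/-- The affine action of `BS(1,n)` on `ℚ`, with `a` acting by `x ↦ 1 + x` and `t` by
`x ↦ n⁻¹ * x`. -/
def BS.affineAction (n : ℕ) (hn : n ≠ 0) : BS n →* Equiv.Perm ℚ :=
  PresentedGroup.toGroup
    (f := fun
      | BSgen.a => Equiv.addLeft 1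
      | BSgen.t => (Equiv.mulLeft₀ (n : ℚ) (Nat.cast_ne_zero.mpr hn))⁻¹) <| by
      rintro r rfl
      simp only [map_mul, map_inv, map_pow, FreeGroup.lift_apply_of, mul_inv_eq_one, inv_inv]
      rw [Equiv.nsmul_addLeft, mul_inv_eq_iff_eq_mul]
      ext x
      simp [mul_add]

theorem BS.affineAction_a (n : ℕ) (hn : n ≠ 0) :
    BS.affineAction n hn (BSa n) = Equiv.addLeft 1 :=
  PresentedGroup.toGroup.of _

/-- The generator `a` has infinite order in `BS(1,n)` for `n ≠ 0`. -/
theorem BSa_pow_injective (n : ℕ) (hn : n ≠ 0) :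
    Function.Injective fun i : ℕ => BSa n ^ i := by
  intro i j h
  have h' := congrArg (fun g => BS.affineAction n hn g 0) h
  simpa [BS.affineAction_a] using h'

/-- For `n ≠ 0`, the map `(i,j) ↦ tˡ·aⁱ·t⁻ʲ` from `ℕ × ℕ` to `BS(1,n)` is injective. -/
theorem BSt_pow_mul_BSa_pow_mul_BSt_zpow_injective (n : ℕ) (hn : n ≠ 0) (l : ℕ) :
    Function.Injective
      fun p : ℕ × ℕ => BSt n ^ l * BSa n ^ p.1 * BSt n ^ (-(p.2 : ℤ)) := by
  rintro ⟨i, j⟩ ⟨i₂, j₂⟩ h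
  obtain rfl : j = j₂ := by
    have h' := congrArg (fun g => (BS.tExponent n g).toAdd) h
    simpa using h'
  have hi : BSa n ^ i = BSa n ^ i₂ := mul_left_cancel (mul_right_cancel h)
  rw [BSa_pow_injective n hn hi]

/-- For `k ≥ 0` and `ℓ ≥ 1`, the map `(i,j) ↦ tˡ·aⁱ·t⁻ʲ` is injective on
`{0,…,(k+1)·2^{ℓ−1}−1} × {0,…,ℓ}`; consequently `#R_{k,ℓ} = (ℓ+1)·(k+1)·2^{ℓ−1}`. -/
theorem rectangle_injective_card (k l : ℕ) (hl : 1 ≤ l) :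
    Set.InjOn (fun p : ℕ × ℕ => BSt 2 ^ l * BSa 2 ^ p.1 * BSt 2 ^ (-(p.2 : ℤ)))
      (Set.Iio ((k + 1) * 2 ^ (l - 1)) ×ˢ Set.Iic l) ∧
    Set.ncard (Rset k l) = (l + 1) * ((k + 1) * 2 ^ (l - 1)) := by
  have hinj := BSt_pow_mul_BSa_pow_mul_BSt_zpow_injective 2 two_ne_zero l
  refine ⟨hinj.injOn, ?_⟩
  have hR : Rset k l =
      (fun p : ℕ × ℕ => BSt 2 ^ l * BSa 2 ^ p.1 * BSt 2 ^ (-(p.2 : ℤ))) ''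
        (Set.Iio ((k + 1) * 2 ^ (l - 1)) ×ˢ Set.Iic l) := by
    ext g
    simp [Rset, and_assoc, eq_comm]
  rw [hR, Set.ncard_image_of_injective _ hinj, Set.ncard_prod]
  simp [Set.ncard_eq_toFinset_card', mul_comm]
end

section
/- The family of rectangles (R_{k,ℓ}) is a (right) Følner net for BS(1,2): for every g ∈ BS(1,2) and every ε > 0 there exist K and L such that for all k ≥ K and ℓ ≥ L, the cardinality of the symmetric difference (R_{k,ℓ}·g) △ R_{k,ℓ} is at most ε times the cardinality of R_{k,ℓ}. -/
/-- The action of the generators of `BS(1,2)` on `ℚ` by the affine maps `x ↦ x + 1` and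
`x ↦ x / 2`. -/
noncomputable def affineGen : BSgen → Equiv.Perm ℚ
  | BSgen.a => Equiv.addRight 1
  | BSgen.t => Equiv.mulRight₀ (2⁻¹ : ℚ) (by norm_num)

/-- The action of `BS(1,2)` on `ℚ` by affine maps. -/
noncomputable def affineHom : BS 2 →* Equiv.Perm ℚ :=
  PresentedGroup.toGroup (f := affineGen) (by
    rintro r rfl
    ext x
    simp [affineGen, pow_two, Equiv.Perm.mul_apply, Equiv.Perm.inv_def, Equiv.mulRight₀]
    ring)

theorem affineHom_a_apply (x : ℚ) : affineHom (BSa 2) x = x + 1 := by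
  simp [affineHom, BSa, affineGen]

theorem affineHom_t_apply (x : ℚ) : affineHom (BSt 2) x = x * 2⁻¹ := by
  simp [affineHom, BSt, affineGen]

theorem affineHom_a_pow_apply (i : ℕ) (x : ℚ) : affineHom (BSa 2 ^ i) x = x + i := by
  induction i generalizing x with
  | zero => simp
  | succ i ih =>
    rw [pow_succ, map_mul, Equiv.Perm.mul_apply, affineHom_a_apply, ih]
    push_cast
    ring

theorem affineHom_t_inv_pow_apply (j : ℕ) (x : ℚ) :
    affineHom (BSt 2 ^ (-(j : ℤ))) x = x * 2 ^ j := by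
  have h (j : ℕ) (x : ℚ) : affineHom (BSt 2 ^ j) (x * 2 ^ j) = x := by
    induction j generalizing x with
    | zero => simp
    | succ j ih =>
      rw [pow_succ, map_mul affineHom, Equiv.Perm.mul_apply, affineHom_t_apply]
      convert ih x using 2
      ring
  rw [zpow_neg, zpow_natCast, map_inv, Equiv.Perm.inv_eq_iff_eq]
  exact (h j x).symm

/-- The element `tˡ·aⁱ·t⁻ʲ`, as a function of `(i, j)`. -/
def rectPoint (l : ℕ) (p : ℕ × ℕ) : BS 2 :=
  BSt 2 ^ l * BSa 2 ^ p.1 * BSt 2 ^ (-(p.2 : ℤ))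

theorem rectPoint_injective (l : ℕ) : Function.Injective (rectPoint l) := by
  rintro ⟨i, j⟩ ⟨i', j'⟩ h
  simp only [rectPoint, mul_assoc, mul_right_inj] at h
  have key (x : ℚ) : x * 2 ^ j + i = x * 2 ^ j' + i' := by
    have := congrArg (fun g => affineHom g x) h
    simpa only [map_mul, Equiv.Perm.mul_apply, affineHom_a_pow_apply,
      affineHom_t_inv_pow_apply] using this
  have hi : (i : ℚ) = i' := by simpa using key 0
  have hj : (2 : ℚ) ^ j = 2 ^ j' := by simpa [hi] using key 1
  exact Prod.ext (by exact_mod_cast hi)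
    (Nat.pow_right_injective le_rfl (by exact_mod_cast hj))

theorem Rset_eq_image (k l : ℕ) :
    Rset k l = rectPoint l ''
      ((Finset.range ((k + 1) * 2 ^ (l - 1)) ×ˢ Finset.range (l + 1) : Finset (ℕ × ℕ)) :
        Set (ℕ × ℕ)) := by
  ext g
  constructor
  · rintro ⟨i, j, hi, hj, rfl⟩
    exact ⟨(i, j), by simp; omega, rfl⟩
  · rintro ⟨⟨i, j⟩, h, rfl⟩
    simp only [Finset.coe_product, Set.mem_prod, Finset.mem_coe, Finset.mem_range] at h
    exact ⟨i, j, h.1, by omega, rfl⟩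

theorem Rset_finite (k l : ℕ) : (Rset k l).Finite := by
  rw [Rset_eq_image]
  exact (Finset.finite_toSet _).image _

theorem ncard_Rset (k l : ℕ) : (Rset k l).ncard = (k + 1) * 2 ^ (l - 1) * (l + 1) := by
  rw [Rset_eq_image, Set.ncard_image_of_injective _ (rectPoint_injective l),
    Set.ncard_coe_finset]
  simp

theorem BSt_inv_mul_BSa : (BSt 2)⁻¹ * BSa 2 = BSa 2 ^ 2 * (BSt 2)⁻¹ := by
  have h : (BSt 2)⁻¹ * BSa 2 * BSt 2 * (BSa 2 ^ 2)⁻¹ = 1 :=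
    PresentedGroup.one_of_mem (rels := BSrel 2) rfl
  rw [eq_mul_inv_iff_mul_eq]
  exact mul_inv_eq_one.mp h

theorem BSt_inv_mul_BSa_pow (i : ℕ) :
    (BSt 2)⁻¹ * BSa 2 ^ i = BSa 2 ^ (2 * i) * (BSt 2)⁻¹ := by
  have h : SemiconjBy (BSt 2)⁻¹ (BSa 2) (BSa 2 ^ 2) := BSt_inv_mul_BSa
  simpa only [SemiconjBy, ← pow_mul] using h.pow_right i

theorem BSt_zpow_neg_mul_BSa (j : ℕ) :
    BSt 2 ^ (-(j : ℤ)) * BSa 2 = BSa 2 ^ 2 ^ j * BSt 2 ^ (-(j : ℤ)) := by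
  simp only [zpow_neg, zpow_natCast, ← inv_pow]
  induction j with
  | zero => simp
  | succ j ih =>
    rw [pow_succ', mul_assoc, ih, ← mul_assoc, BSt_inv_mul_BSa_pow, mul_assoc,
      pow_succ' 2 j]

theorem rectPoint_mul_BSa (l i j : ℕ) :
    rectPoint l (i, j) * BSa 2 = rectPoint l (i + 2 ^ j, j) := by
  simp only [rectPoint, mul_assoc, BSt_zpow_neg_mul_BSa, pow_add]

theorem rectPoint_succ_mul_BSt (l i j : ℕ) :
    rectPoint l (i, j + 1) * BSt 2 = rectPoint l (i, j) := by
  simp only [rectPoint, mul_assoc, mul_right_inj, ← zpow_add_one]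
  congr 1
  push_cast
  ring

theorem ncard_image_mul_right {G : Type*} [Group G] (s : Set G) (g : G) :
    ((fun r => r * g) '' s).ncard = s.ncard :=
  Set.ncard_image_of_injective _ (mul_left_injective g)

theorem ncard_symmDiff_le {G : Type*} {s u : Set G} (hs : s.Finite) (hu : u.Finite)
    (h : s.ncard = u.ncard) : (symmDiff s u).ncard ≤ 2 * (s \ u).ncard := by
  have h' := (Set.ncard_eq_ncard_iff_ncard_sdiff_eq_ncard_sdiff hs hu).mp h
  have := Set.ncard_union_le (s \ u) (u \ s)
  rw [Set.symmDiff_def]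
  omega

theorem ncard_symmDiff_Rset_mul_le (k l : ℕ) (g : BS 2) :
    (symmDiff ((fun r => r * g) '' Rset k l) (Rset k l)).ncard ≤
      2 * (((fun r => r * g) '' Rset k l) \ Rset k l).ncard :=
  ncard_symmDiff_le ((Rset_finite k l).image _) (Rset_finite k l) (ncard_image_mul_right _ _)

theorem ncard_Rset_mul_BSa_diff_le (k l : ℕ) :
    (((fun r => r * BSa 2) '' Rset k l) \ Rset k l).ncard ≤ 2 ^ l * (l + 1) := by
  set N := (k + 1) * 2 ^ (l - 1) with hN
  have hsub : ((fun r => r * BSa 2) '' Rset k l) \ Rset k l ⊆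
      (fun p : ℕ × ℕ => rectPoint l (N + p.1, p.2)) ''
        ((Finset.range (2 ^ l) ×ˢ Finset.range (l + 1) : Finset (ℕ × ℕ)) : Set (ℕ × ℕ)) := by
    rintro _ ⟨⟨_, ⟨i, j, hi, hj, rfl⟩, rfl⟩, hn⟩
    change rectPoint l (i, j) * BSa 2 ∉ _ at hn
    change rectPoint l (i, j) * BSa 2 ∈ _
    rw [rectPoint_mul_BSa] at hn ⊢
    have hNi : N ≤ i + 2 ^ j := by
      by_contra! hlt
      exact hn ⟨_, j, hlt, hj, rfl⟩
    have hpow : 2 ^ j ≤ 2 ^ l := Nat.pow_le_pow_right two_pos hj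
    refine ⟨(i + 2 ^ j - N, j), ?_, ?_⟩
    · simp only [Finset.coe_product, Set.mem_prod, Finset.mem_coe, Finset.mem_range]
      omega
    · simp only [Nat.add_sub_cancel' hNi]
  refine (Set.ncard_le_ncard hsub ((Finset.finite_toSet _).image _)).trans
    ((Set.ncard_image_le (Finset.finite_toSet _)).trans ?_)
  rw [Set.ncard_coe_finset]
  simp

theorem ncard_Rset_mul_BSt_diff_le (k l : ℕ) :
    (((fun r => r * BSt 2) '' Rset k l) \ Rset k l).ncard ≤ (k + 1) * 2 ^ (l - 1) := by
  have hsub : ((fun r => r * BSt 2) '' Rset k l) \ Rset k l ⊆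
      (fun i : ℕ => rectPoint l (i, 0) * BSt 2) ''
        (Finset.range ((k + 1) * 2 ^ (l - 1)) : Set ℕ) := by
    rintro _ ⟨⟨_, ⟨i, j, hi, hj, rfl⟩, rfl⟩, hn⟩
    change rectPoint l (i, j) * BSt 2 ∉ _ at hn
    change rectPoint l (i, j) * BSt 2 ∈ _
    cases j with
    | zero => exact ⟨i, by simpa using hi, rfl⟩
    | succ j =>
      rw [rectPoint_succ_mul_BSt] at hn
      exact absurd ⟨i, j, hi, by omega, rfl⟩ hn
  refine (Set.ncard_le_ncard hsub ((Finset.finite_toSet _).image _)).trans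
    ((Set.ncard_image_le (Finset.finite_toSet _)).trans ?_)
  rw [Set.ncard_coe_finset]
  simp

/-- The rectangles are asymptotically invariant under right translation by `g`. -/
def RectInvariant (g : BS 2) : Prop :=
  ∀ ε : ℝ, 0 < ε → ∃ K L : ℕ, 1 ≤ L ∧ ∀ k, K ≤ k → ∀ l, L ≤ l →
    (Set.ncard (symmDiff ((fun r => r * g) '' Rset k l) (Rset k l)) : ℝ)
      ≤ ε * (Set.ncard (Rset k l) : ℝ)

theorem rectInvariant_BSa : RectInvariant (BSa 2) := by
  intro ε hε
  obtain ⟨K, hK⟩ := exists_nat_ge (4 / ε)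
  refine ⟨K, 1, le_rfl, fun k hk l hl => ?_⟩
  obtain ⟨m, rfl⟩ := Nat.exists_eq_add_of_le' hl
  have h : (symmDiff ((fun r => r * BSa 2) '' Rset k (m + 1)) (Rset k (m + 1))).ncard ≤
      2 * (2 ^ (m + 1) * (m + 1 + 1)) :=
    (ncard_symmDiff_Rset_mul_le _ _ _).trans
      (Nat.mul_le_mul_left 2 (ncard_Rset_mul_BSa_diff_le _ _))
  have hk' : (K : ℝ) ≤ k := by exact_mod_cast hk
  have hεk : 4 ≤ ε * (k + 1) := by
    rw [div_le_iff₀ hε] at hK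
    nlinarith
  calc _ ≤ ((2 * (2 ^ (m + 1) * (m + 1 + 1)) : ℕ) : ℝ) := by exact_mod_cast h
    _ = 4 * (2 ^ m * (m + 1 + 1)) := by push_cast; ring
    _ ≤ ε * (k + 1) * (2 ^ m * (m + 1 + 1)) := by gcongr
    _ = _ := by rw [ncard_Rset, Nat.add_sub_cancel]; push_cast; ring

theorem rectInvariant_BSt : RectInvariant (BSt 2) := by
  intro ε hε
  obtain ⟨L, hL⟩ := exists_nat_ge (2 / ε)
  refine ⟨0, L + 1, by omega, fun k _ l hl => ?_⟩
  have h : (symmDiff ((fun r => r * BSt 2) '' Rset k l) (Rset k l)).ncard ≤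
      2 * ((k + 1) * 2 ^ (l - 1)) :=
    (ncard_symmDiff_Rset_mul_le _ _ _).trans
      (Nat.mul_le_mul_left 2 (ncard_Rset_mul_BSt_diff_le _ _))
  have hl' : (L : ℝ) + 1 ≤ l := by exact_mod_cast hl
  have hεl : 2 ≤ ε * (l + 1) := by
    rw [div_le_iff₀ hε] at hL
    nlinarith
  calc _ ≤ ((2 * ((k + 1) * 2 ^ (l - 1)) : ℕ) : ℝ) := by exact_mod_cast h
    _ = 2 * ((k + 1) * 2 ^ (l - 1)) := by push_cast; ring
    _ ≤ ε * (l + 1) * ((k + 1) * 2 ^ (l - 1)) := by gcongr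
    _ = _ := by rw [ncard_Rset]; push_cast; ring

theorem RectInvariant.one : RectInvariant 1 := fun ε hε =>
  ⟨0, 1, le_rfl, fun k _ l _ => by
    simp only [mul_one, Set.image_id', symmDiff_self, Set.bot_eq_empty, Set.ncard_empty,
      Nat.cast_zero]
    positivity⟩

theorem RectInvariant.mul {g h : BS 2} (hg : RectInvariant g) (hh : RectInvariant h) :
    RectInvariant (g * h) := by
  intro ε hε
  obtain ⟨K, L, hL, H⟩ := hg (ε / 2) (half_pos hε)
  obtain ⟨K', L', _, H'⟩ := hh (ε / 2) (half_pos hε)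
  refine ⟨max K K', max L L', le_max_of_le_left hL, fun k hk l hl => ?_⟩
  have h1 := H k (le_of_max_le_left hk) l (le_of_max_le_left hl)
  have h2 := H' k (le_of_max_le_right hk) l (le_of_max_le_right hl)
  set R := Rset k l with hR
  have hfin : R.Finite := Rset_finite k l
  have hcomp : (fun r => r * (g * h)) '' R = (fun r => r * h) '' ((fun r => r * g) '' R) := by
    simp only [Set.image_image, mul_assoc]
  have hsub : symmDiff ((fun r => r * (g * h)) '' R) R ⊆
      (fun r => r * h) '' symmDiff ((fun r => r * g) '' R) R ∪
        symmDiff ((fun r => r * h) '' R) R := by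
    rw [Set.image_symmDiff (mul_left_injective h), ← hcomp]
    exact symmDiff_triangle _ _ _
  have hle := (Set.ncard_le_ncard hsub
    ((((hfin.image _).symmDiff hfin).image _).union ((hfin.image _).symmDiff hfin))).trans
    (Set.ncard_union_le _ _)
  rw [ncard_image_mul_right] at hle
  have hle' : ((symmDiff ((fun r => r * (g * h)) '' R) R).ncard : ℝ) ≤
      (symmDiff ((fun r => r * g) '' R) R).ncard +
        (symmDiff ((fun r => r * h) '' R) R).ncard := by exact_mod_cast hle
  linarith

theorem RectInvariant.inv {g : BS 2} (hg : RectInvariant g) : RectInvariant g⁻¹ := by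
  intro ε hε
  obtain ⟨K, L, hL, H⟩ := hg ε hε
  refine ⟨K, L, hL, fun k hk l hl => ?_⟩
  have heq : (fun r => r * g) '' symmDiff ((fun r => r * g⁻¹) '' Rset k l) (Rset k l) =
      symmDiff ((fun r => r * g) '' Rset k l) (Rset k l) := by
    rw [Set.image_symmDiff (mul_left_injective g), Set.image_image, symmDiff_comm]
    simp
  rw [← ncard_image_mul_right _ g, heq]
  exact H k hk l hl

theorem rectInvariant (g : BS 2) : RectInvariant g := by
  have hg : g ∈ Subgroup.closure (Set.range (PresentedGroup.of (rels := BSrel 2))) := by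
    rw [PresentedGroup.closure_range_of]
    trivial
  induction hg using Subgroup.closure_induction with
  | mem x hx =>
    obtain ⟨_ | _, rfl⟩ := hx
    · exact rectInvariant_BSa
    · exact rectInvariant_BSt
  | one => exact RectInvariant.one
  | mul x y _ _ hx hy => exact hx.mul hy
  | inv x _ hx => exact hx.inv

/-- The rectangles `(R_{k,ℓ})` form a (right) Følner net for `BS(1,2)`: for every
`g ∈ BS(1,2)` and `ε > 0` there are `K`, `L ≥ 1` such that for all `k ≥ K`, `ℓ ≥ L`,
`#((R_{k,ℓ}·g) △ R_{k,ℓ}) ≤ ε · #R_{k,ℓ}`. -/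
theorem rectangles_folner (g : BS 2) (ε : ℝ) (hε : 0 < ε) :
    ∃ K L : ℕ, 1 ≤ L ∧ ∀ k, K ≤ k → ∀ l, L ≤ l →
      (Set.ncard (symmDiff ((fun r => r * g) '' Rset k l) (Rset k l)) : ℝ)
        ≤ ε * (Set.ncard (Rset k l) : ℝ) :=
  rectInvariant g ε hε
end

section
/- Let σ be a substitution on a finite alphabet 𝒜 with an expanding eigenvalue λ > 1 and positive eigenvector v. Then there exists a σ-tiling of ℝ². -/
/-- The closed rectangle occupied by an `a`-tile at position `(x,y)`:
`[x, x + v(a)·2^y] × [y − log₂ λ, y]`. -/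
noncomputable def tileRect {A : Type} (v : A → ℝ) (lam : ℝ) (s : A × ℝ × ℝ) : Set (ℝ × ℝ) :=
  Set.Icc s.2.1 (s.2.1 + v s.1 * (2 : ℝ) ^ s.2.2) ×ˢ
    Set.Icc (s.2.2 - Real.logb 2 lam) s.2.2

/-- The interior of the rectangle occupied by a tile. -/
noncomputable def tileInterior {A : Type} (v : A → ℝ) (lam : ℝ) (s : A × ℝ × ℝ) : Set (ℝ × ℝ) :=
  Set.Ioo s.2.1 (s.2.1 + v s.1 * (2 : ℝ) ^ s.2.2) ×ˢ
    Set.Ioo (s.2.2 - Real.logb 2 lam) s.2.2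

/-- The half-open rectangle `[x, x + v(a)·2^y) × (y − log₂ λ, y]` of a tile. -/
noncomputable def tileHalfOpen {A : Type} (v : A → ℝ) (lam : ℝ) (s : A × ℝ × ℝ) : Set (ℝ × ℝ) :=
  Set.Ico s.2.1 (s.2.1 + v s.1 * (2 : ℝ) ^ s.2.2) ×ˢ
    Set.Ioc (s.2.2 - Real.logb 2 lam) s.2.2

/-- `λ > 1` is an expanding eigenvalue of the substitution `σ` with positive eigenvector `v`:
`λ·v(a) = Σᵢ v(σ(a)ᵢ)` for every letter `a`. -/
def ExpandingEV {A : Type} (σ : A → List A) (lam : ℝ) (v : A → ℝ) : Prop :=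
  1 < lam ∧ (∀ a, 0 < v a) ∧ ∀ a, lam * v a = ((σ a).map v).sum

/-- `T ⊆ 𝒜 × ℝ²` is a `σ`-tiling of `ℝ²`: interiors of distinct tiles are disjoint, the
tiles cover the plane, and below each `a`-tile sit the tiles of the word `σ(a)`. -/
structure IsTiling {A : Type} (σ : A → List A) (v : A → ℝ) (lam : ℝ)
    (T : Set (A × ℝ × ℝ)) : Prop where
  disjoint : ∀ s ∈ T, ∀ u ∈ T, s ≠ u → tileInterior v lam s ∩ tileInterior v lam u = ∅
  covers : ∀ p : ℝ × ℝ, ∃ s ∈ T, p ∈ tileRect v lam s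
  subst : ∀ s ∈ T, ∀ j : Fin (σ s.1).length,
    ((σ s.1).get j,
      (s.2.1 + ((2 : ℝ) ^ s.2.2 / lam) * (((σ s.1).take (j : ℕ)).map v).sum,
        s.2.2 - Real.logb 2 lam)) ∈ T

open Filter Topology

/-- The `j`-th tile below an `a`-tile at position `q`. -/
noncomputable def childTile {A : Type} (σ : A → List A) (v : A → ℝ) (lam : ℝ) (a : A)
    (j : Fin (σ a).length) (q : ℝ × ℝ) : A × ℝ × ℝ :=
  ((σ a).get j,
    (q.1 + ((2 : ℝ) ^ q.2 / lam) * (((σ a).take (j : ℕ)).map v).sum, q.2 - Real.logb 2 lam))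

/-- `c` is one of the tiles directly below `s`. -/
def IsChild {A : Type} (σ : A → List A) (v : A → ℝ) (lam : ℝ) (s c : A × ℝ × ℝ) : Prop :=
  ∃ j, c = childTile σ v lam s.1 j s.2

/-- The tiles obtained from `s` by iterated substitution, including `s` itself. -/
def descendants {A : Type} (σ : A → List A) (v : A → ℝ) (lam : ℝ) (s : A × ℝ × ℝ) :
    Set (A × ℝ × ℝ) :=
  {u | Relation.ReflTransGen (IsChild σ v lam) s u}

/-- The horizontal extent of a tile, without its endpoints. -/
noncomputable def tileColumn {A : Type} (v : A → ℝ) (s : A × ℝ × ℝ) : Set ℝ :=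
  Set.Ioo s.2.1 (s.2.1 + v s.1 * (2 : ℝ) ^ s.2.2)

theorem two_rpow_sub_logb {lam : ℝ} (h : 1 < lam) (y : ℝ) :
    (2 : ℝ) ^ (y - Real.logb 2 lam) = 2 ^ y / lam := by
  rw [Real.rpow_sub two_pos, Real.rpow_logb two_pos (by norm_num) (by linarith)]

theorem sum_map_take_succ {A : Type} (v : A → ℝ) (l : List A) (j : Fin l.length) :
    ((l.take (j + 1)).map v).sum = ((l.take j).map v).sum + v (l.get j) := by
  rw [List.take_succ_eq_append_getElem j.2]
  simp

theorem sum_map_take_mono {A : Type} {v : A → ℝ} (hv : ∀ a, 0 < v a) (l : List A) :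
    Monotone fun i => ((l.take i).map v).sum := by
  intro i j hij
  have h : (l.take i).Sublist (l.take j) := (List.take_prefix_take_left hij).sublist
  exact (h.map v).sum_le_sum (by simp only [List.mem_map]; rintro _ ⟨a, _, rfl⟩; exact (hv a).le)

theorem exists_sum_map_take_le {A : Type} (v : A → ℝ) (l : List A) (hl : l ≠ []) (t : ℝ)
    (h0 : 0 ≤ t) (h1 : t ≤ (l.map v).sum) :
    ∃ j : Fin l.length,
      ((l.take j).map v).sum ≤ t ∧ t ≤ ((l.take j).map v).sum + v (l.get j) := by
  by_contra! H
  have key : ∀ i ≤ l.length, ((l.take i).map v).sum ≤ t := by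
    intro i
    induction i with
    | zero => simpa using h0
    | succ i ih =>
      intro hi
      rw [sum_map_take_succ v l ⟨i, hi⟩]
      exact (H ⟨i, hi⟩ (ih (by omega))).le
  have hpos := List.length_pos_iff.mpr hl
  have hlast := H ⟨l.length - 1, by omega⟩ (key _ (by omega))
  rw [← sum_map_take_succ] at hlast
  simp only [Nat.sub_add_cancel hpos, List.take_length] at hlast
  linarith

section Descendants

variable {A : Type} {σ : A → List A} {lam : ℝ} {v : A → ℝ}

theorem childTile_right_end (hEV : ExpandingEV σ lam v) (a : A) (j : Fin (σ a).length)
    (q : ℝ × ℝ) :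
    (childTile σ v lam a j q).2.1 +
        v (childTile σ v lam a j q).1 * 2 ^ (childTile σ v lam a j q).2.2 =
      q.1 + ((2 : ℝ) ^ q.2 / lam) * (((σ a).take (j + 1)).map v).sum := by
  rw [sum_map_take_succ]
  simp only [childTile, two_rpow_sub_logb hEV.1]
  ring

theorem right_end_eq (hEV : ExpandingEV σ lam v) (a : A) (q : ℝ × ℝ) :
    q.1 + v a * (2 : ℝ) ^ q.2 = q.1 + ((2 : ℝ) ^ q.2 / lam) * ((σ a).map v).sum := by
  have := hEV.1
  rw [← hEV.2.2 a]
  field_simp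

theorem two_rpow_div_pos (hEV : ExpandingEV σ lam v) (y : ℝ) : 0 < (2 : ℝ) ^ y / lam :=
  div_pos (Real.rpow_pos_of_pos two_pos y) (by linarith [hEV.1])

theorem IsChild.tileColumn_subset (hEV : ExpandingEV σ lam v) {s c : A × ℝ × ℝ}
    (h : IsChild σ v lam s c) : tileColumn v c ⊆ tileColumn v s := by
  obtain ⟨j, rfl⟩ := h
  have hp := (two_rpow_div_pos hEV s.2.2).le
  refine Set.Ioo_subset_Ioo ?_ ?_
  · have := sum_map_take_mono hEV.2.1 (σ s.1) (Nat.zero_le j)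
    simp only [List.take_zero, List.map_nil, List.sum_nil] at this
    exact le_add_of_nonneg_right (mul_nonneg hp this)
  · have := sum_map_take_mono hEV.2.1 (σ s.1) (Nat.succ_le_of_lt j.2)
    simp only [List.take_length, Nat.succ_eq_add_one] at this
    rw [childTile_right_end hEV, right_end_eq hEV]
    gcongr

theorem IsChild.eq_of_mem_tileColumn (hEV : ExpandingEV σ lam v) {s c d : A × ℝ × ℝ}
    (hc : IsChild σ v lam s c) (hd : IsChild σ v lam s d) {t : ℝ} (htc : t ∈ tileColumn v c)
    (htd : t ∈ tileColumn v d) : c = d := by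
  obtain ⟨i, rfl⟩ := hc
  obtain ⟨j, rfl⟩ := hd
  have aux : ∀ {i j : Fin (σ s.1).length}, t ∈ tileColumn v (childTile σ v lam s.1 i s.2) →
      t ∈ tileColumn v (childTile σ v lam s.1 j s.2) → ¬ i < j := by
    intro i j hi hj hij
    have h1 := hi.2
    rw [childTile_right_end hEV] at h1
    have h2 : s.2.1 + ((2 : ℝ) ^ s.2.2 / lam) * (((σ s.1).take (j : ℕ)).map v).sum < t := hj.1
    have := mul_le_mul_of_nonneg_left
      (sum_map_take_mono hEV.2.1 (σ s.1) (Nat.succ_le_of_lt hij))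
      (two_rpow_div_pos hEV s.2.2).le
    simp only [Nat.succ_eq_add_one] at this
    linarith
  rw [le_antisymm (not_lt.mp (aux htd htc)) (not_lt.mp (aux htc htd))]

theorem tileColumn_subset_of_mem_descendants (hEV : ExpandingEV σ lam v) {s u : A × ℝ × ℝ}
    (h : u ∈ descendants σ v lam s) : tileColumn v u ⊆ tileColumn v s := by
  induction h with
  | refl => exact subset_rfl
  | tail _ hc ih => exact (hc.tileColumn_subset hEV).trans ih

theorem height_le_of_mem_descendants (hEV : ExpandingEV σ lam v) {s u : A × ℝ × ℝ}
    (h : u ∈ descendants σ v lam s) : u.2.2 ≤ s.2.2 := by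
  induction h with
  | refl => exact le_rfl
  | tail _ hc ih =>
    obtain ⟨j, rfl⟩ := hc
    have := Real.logb_pos one_lt_two hEV.1
    simp only [childTile]
    linarith

theorem not_mem_tileInterior_of_child (hEV : ExpandingEV σ lam v) {s c u : A × ℝ × ℝ}
    (hc : IsChild σ v lam s c) (hu : u ∈ descendants σ v lam c) {p : ℝ × ℝ}
    (hps : p ∈ tileInterior v lam s) : p ∉ tileInterior v lam u := by
  intro hpu
  have h1 := height_le_of_mem_descendants hEV hu
  obtain ⟨j, rfl⟩ := hc
  have h2 := hps.2.1
  have h3 := hpu.2.2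
  simp only [childTile] at h1
  linarith

theorem eq_of_mem_tileInterior_descendants (hEV : ExpandingEV σ lam v) {s u t : A × ℝ × ℝ}
    (hu : u ∈ descendants σ v lam s) (ht : t ∈ descendants σ v lam s) {p : ℝ × ℝ}
    (hpu : p ∈ tileInterior v lam u) (hpt : p ∈ tileInterior v lam t) : u = t := by
  induction hu using Relation.ReflTransGen.head_induction_on with
  | refl =>
    rcases Relation.ReflTransGen.cases_head ht with rfl | ⟨c, hc, hct⟩
    · rfl
    · exact (not_mem_tileInterior_of_child hEV hc hct hpu hpt).elim
  | head hc hcu ih =>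
    rcases Relation.ReflTransGen.cases_head ht with rfl | ⟨d, hd, hdt⟩
    · exact (not_mem_tileInterior_of_child hEV hc hcu hpt hpu).elim
    · obtain rfl := hc.eq_of_mem_tileColumn hEV hd
        (tileColumn_subset_of_mem_descendants hEV hcu hpu.1)
        (tileColumn_subset_of_mem_descendants hEV hdt hpt.1)
      exact ih hdt

theorem exists_child_column (hσ : ∀ a, σ a ≠ []) (hEV : ExpandingEV σ lam v)
    (s : A × ℝ × ℝ) {t : ℝ} (ht : t ∈ Set.Icc s.2.1 (s.2.1 + v s.1 * (2 : ℝ) ^ s.2.2)) :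
    ∃ c, IsChild σ v lam s c ∧ t ∈ Set.Icc c.2.1 (c.2.1 + v c.1 * (2 : ℝ) ^ c.2.2) ∧
      c.2.2 = s.2.2 - Real.logb 2 lam := by
  have hp := two_rpow_div_pos hEV s.2.2
  rw [right_end_eq hEV] at ht
  obtain ⟨j, h1, h2⟩ := exists_sum_map_take_le v (σ s.1) (hσ _)
    ((t - s.2.1) / ((2 : ℝ) ^ s.2.2 / lam))
    (div_nonneg (by linarith [ht.1]) hp.le)
    ((div_le_iff₀' hp).mpr (by linarith [ht.2]))
  refine ⟨childTile σ v lam s.1 j s.2, ⟨j, rfl⟩, ⟨?_, ?_⟩, rfl⟩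
  · rw [le_div_iff₀' hp] at h1
    simp only [childTile]
    linarith
  · rw [← sum_map_take_succ, div_le_iff₀' hp] at h2
    rw [childTile_right_end hEV]
    linarith

theorem exists_descendant_covering (hσ : ∀ a, σ a ≠ []) (hEV : ExpandingEV σ lam v)
    (s : A × ℝ × ℝ) (p : ℝ × ℝ)
    (hx : p.1 ∈ Set.Icc s.2.1 (s.2.1 + v s.1 * (2 : ℝ) ^ s.2.2)) (hy : p.2 ≤ s.2.2) :
    ∃ u ∈ descendants σ v lam s, p ∈ tileRect v lam u := by
  have hL := Real.logb_pos one_lt_two hEV.1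
  obtain ⟨k, hk⟩ := exists_nat_ge ((s.2.2 - p.2) / Real.logb 2 lam)
  rw [div_le_iff₀ hL] at hk
  induction k generalizing s with
  | zero =>
    simp only [Nat.cast_zero, zero_mul] at hk
    exact ⟨s, .refl, hx, by linarith, hy⟩
  | succ k ih =>
    by_cases h : s.2.2 - Real.logb 2 lam ≤ p.2
    · exact ⟨s, .refl, hx, h, hy⟩
    · obtain ⟨c, hc, hxc, hyc⟩ := exists_child_column hσ hEV s hx
      push_cast at hk
      obtain ⟨u, hu, hpu⟩ := ih c hxc (by linarith) (by linarith)
      exact ⟨u, .head hc hu, hpu⟩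

end Descendants

section Limit

variable {A : Type} [TopologicalSpace A] {ι : Type*}

/-- The limits along `F` of families of tiles eventually chosen from `T i`. -/
def limitTiles (F : Filter ι) (T : ι → Set (A × ℝ × ℝ)) : Set (A × ℝ × ℝ) :=
  {s | ∃ r : ι → A × ℝ × ℝ, (∀ᶠ i in F, r i ∈ T i) ∧ Tendsto r F (𝓝 s)}

variable [DiscreteTopology A]

theorem continuous_tile_right_end (v : A → ℝ) :
    Continuous fun s : A × ℝ × ℝ => s.2.1 + v s.1 * (2 : ℝ) ^ s.2.2 := by
  have hv : Continuous fun s : A × ℝ × ℝ => v s.1 :=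
    continuous_of_discreteTopology.comp continuous_fst
  have h2 : Continuous fun s : A × ℝ × ℝ => (2 : ℝ) ^ s.2.2 :=
    (Real.continuous_const_rpow two_ne_zero).comp (by fun_prop)
  fun_prop

theorem isOpen_setOf_mem_tileInterior (v : A → ℝ) (lam : ℝ) (p : ℝ × ℝ) :
    IsOpen {s | p ∈ tileInterior v lam s} := by
  have h := continuous_tile_right_end v
  simp only [tileInterior, Set.mem_prod, Set.mem_Ioo]
  refine IsOpen.and (IsOpen.and ?_ ?_) (IsOpen.and ?_ ?_) <;>
    exact isOpen_lt (by fun_prop) (by fun_prop)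

theorem isClosed_setOf_mem_tileRect (v : A → ℝ) (lam : ℝ) (p : ℝ × ℝ) :
    IsClosed {s | p ∈ tileRect v lam s} := by
  have h := continuous_tile_right_end v
  simp only [tileRect, Set.mem_prod, Set.mem_Icc]
  refine IsClosed.and (IsClosed.and ?_ ?_) (IsClosed.and ?_ ?_) <;>
    exact isClosed_le (by fun_prop) (by fun_prop)

theorem isCompact_setOf_mem_tileRect [Finite A] {v : A → ℝ} (hv : ∀ a, 0 < v a) (lam : ℝ)
    (p : ℝ × ℝ) : IsCompact {s | p ∈ tileRect v lam s} := by
  obtain ⟨M, hM⟩ := (Set.finite_range v).bddAbove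
  refine (isCompact_univ.prod ((isCompact_Icc (a := p.1 - M * 2 ^ (p.2 + Real.logb 2 lam))
    (b := p.1)).prod (isCompact_Icc (a := p.2) (b := p.2 + Real.logb 2 lam)))).of_isClosed_subset
    (isClosed_setOf_mem_tileRect v lam p) ?_
  rintro s ⟨⟨h1, h2⟩, h3, h4⟩
  refine ⟨trivial, ⟨?_, h1⟩, h4, by linarith⟩
  have hMs : v s.1 ≤ M := hM ⟨_, rfl⟩
  have hM0 : 0 ≤ M := (hv s.1).le.trans hMs
  have : v s.1 * (2 : ℝ) ^ s.2.2 ≤ M * 2 ^ (p.2 + Real.logb 2 lam) := by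
    gcongr
    · norm_num
    · linarith
  linarith

theorem isTiling_limitTiles [Finite A] {σ : A → List A} {lam : ℝ} {v : A → ℝ}
    (hv : ∀ a, 0 < v a) (F : Ultrafilter ι) (T : ι → Set (A × ℝ × ℝ))
    (hdisj : ∀ i, ∀ s ∈ T i, ∀ u ∈ T i, ∀ p ∈ tileInterior v lam s,
      p ∈ tileInterior v lam u → s = u)
    (hcov : ∀ p, ∀ᶠ i in (F : Filter ι), ∃ s ∈ T i, p ∈ tileRect v lam s)
    (hsubst : ∀ i, ∀ s ∈ T i, ∀ j, childTile σ v lam s.1 j s.2 ∈ T i) :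
    IsTiling σ v lam (limitTiles (F : Filter ι) T) where
  disjoint := by
    rintro s ⟨r, hr, hrs⟩ u ⟨q, hq, hqu⟩ hsu
    by_contra hne
    obtain ⟨p, hps, hpu⟩ := Set.nonempty_iff_ne_empty.mpr hne
    refine hsu (tendsto_nhds_unique (hrs.congr' ?_) hqu)
    filter_upwards [hr, hq, hrs ((isOpen_setOf_mem_tileInterior v lam p).mem_nhds hps),
      hqu ((isOpen_setOf_mem_tileInterior v lam p).mem_nhds hpu)] with i h1 h2 h3 h4
    exact hdisj i _ h1 _ h2 p h3 h4
  covers p := by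
    obtain ⟨i₀, s₀, -, -⟩ := (hcov p).exists
    have : Nonempty (A × ℝ × ℝ) := ⟨s₀⟩
    obtain ⟨r, hr⟩ := (hcov p).choice
    obtain ⟨s, hs, hrs⟩ := (isCompact_setOf_mem_tileRect hv lam p).ultrafilter_le_nhds (F.map r)
      (tendsto_principal.mpr (hr.mono fun _ h => h.2))
    exact ⟨s, ⟨r, hr.mono fun _ h => h.1, hrs⟩, hs⟩
  subst := by
    rintro s ⟨r, hr, hrs⟩ j
    refine ⟨fun i => childTile σ v lam s.1 j (r i).2, ?_, ?_⟩
    · have hfst : ∀ᶠ i in (F : Filter ι), (r i).1 = s.1 := by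
        have := (continuous_fst.tendsto s).comp hrs
        rwa [nhds_discrete, tendsto_pure] at this
      filter_upwards [hr, hfst] with i h1 h2
      have h := hsubst i _ h1
      rw [h2] at h
      exact h j
    · have h2 : Continuous fun q : ℝ × ℝ => (2 : ℝ) ^ q.2 :=
        (Real.continuous_const_rpow two_ne_zero).comp continuous_snd
      have hc : Continuous (childTile σ v lam s.1 j) := by
        unfold childTile
        fun_prop
      exact ((hc.comp continuous_snd).tendsto s).comp hrs

end Limit

/-- If a substitution on a finite alphabet has an expanding eigenvalue `λ > 1` with
positive eigenvector `v`, then there exists a `σ`-tiling of `ℝ²`. -/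
theorem sigma_tiling_exists {A : Type} [Fintype A] [Nonempty A] (σ : A → List A)
    (hσ : ∀ a, σ a ≠ []) (lam : ℝ) (v : A → ℝ) (hEV : ExpandingEV σ lam v) :
    ∃ T : Set (A × ℝ × ℝ), IsTiling σ v lam T := by
  let : TopologicalSpace A := ⊥
  have : DiscreteTopology A := ⟨rfl⟩
  obtain ⟨a⟩ := ‹Nonempty A›
  have hva := hEV.2.1 a
  let top : ℕ → A × ℝ × ℝ := fun n => (a, -(v a * (2 : ℝ) ^ (n : ℝ) / 2), n)
  refine ⟨_, isTiling_limitTiles hEV.2.1 (hyperfilter ℕ) (fun n => descendants σ v lam (top n))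
    (fun n s hs u hu p hps hpu => eq_of_mem_tileInterior_descendants hEV hs hu hps hpu)
    (fun p => ?_) (fun n s hs j => hs.tail ⟨j, rfl⟩)⟩
  apply Nat.hyperfilter_le_atTop
  have hgrow : Tendsto (fun n : ℕ => v a * (2 : ℝ) ^ (n : ℝ) / 2) atTop atTop := by
    simp only [Real.rpow_natCast]
    exact ((tendsto_pow_atTop_atTop_of_one_lt one_lt_two).const_mul_atTop hva).atTop_div_const
      two_pos
  filter_upwards [hgrow.eventually_ge_atTop |p.1|,
    tendsto_natCast_atTop_atTop.eventually_ge_atTop p.2] with n hx hy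
  rw [abs_le] at hx
  exact exists_descendant_covering hσ hEV (top n) p
    ⟨hx.1, by simp only [top]; linarith [hx.2]⟩ hy
end

section
/- Let σ be a substitution on a finite alphabet 𝒜 with expanding eigenvalue λ and positive eigenvector v. Let (T_m)_{m∈ℕ} be a sequence of σ-tilings and let T ⊆ 𝒜 × ℝ² be such that for every bounded set B ⊆ ℝ² there exists N with: for all m ≥ N, the tiles of T_m whose rectangle intersects B are exactly the tiles of T whose rectangle intersects B. Then T is a σ-tiling. -/
/-- The rectangle of a tile contains the position of the tile. -/
theorem position_mem_tileRect {A : Type} {σ : A → List A} {lam : ℝ} {v : A → ℝ}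
    (hEV : ExpandingEV σ lam v) (s : A × ℝ × ℝ) : s.2 ∈ tileRect v lam s := by
  have hlog : 0 < Real.logb 2 lam := Real.logb_pos one_lt_two hEV.1
  have hwidth : 0 < v s.1 * (2 : ℝ) ^ s.2.2 := mul_pos (hEV.2.1 _) (by positivity)
  exact ⟨⟨le_rfl, by linarith⟩, ⟨by linarith, le_rfl⟩⟩

/-- If the sets `Tseq m` converge locally to `T`, then on any two given tiles some `Tseq m`
has the same members as `T`. -/
theorem exists_mem_iff_mem_pair {A : Type} {σ : A → List A} {lam : ℝ} {v : A → ℝ}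
    (hEV : ExpandingEV σ lam v) {Tseq : ℕ → Set (A × ℝ × ℝ)} {T : Set (A × ℝ × ℝ)}
    (hconv : ∀ B : Set (ℝ × ℝ), Bornology.IsBounded B → ∃ N, ∀ m, N ≤ m →
      {s ∈ Tseq m | (tileRect v lam s ∩ B).Nonempty} =
        {s ∈ T | (tileRect v lam s ∩ B).Nonempty}) (s u : A × ℝ × ℝ) :
    ∃ m, (s ∈ Tseq m ↔ s ∈ T) ∧ (u ∈ Tseq m ↔ u ∈ T) := by
  obtain ⟨N, hN⟩ := hconv {s.2, u.2} (Set.toFinite _).isBounded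
  have key : ∀ w : A × ℝ × ℝ, w.2 ∈ ({s.2, u.2} : Set (ℝ × ℝ)) → (w ∈ Tseq N ↔ w ∈ T) := by
    intro w hw
    have hmeet : (tileRect v lam w ∩ {s.2, u.2}).Nonempty :=
      ⟨w.2, position_mem_tileRect hEV w, hw⟩
    have hiff := Set.ext_iff.mp (hN N le_rfl) w
    simpa only [Set.mem_ofPred_eq, hmeet, and_true] using hiff
  exact ⟨N, key s (by simp), key u (by simp)⟩

/-- A local limit of `σ`-tilings is a `σ`-tiling: if for every bounded `B ⊆ ℝ²` the tiles
of `T_m` whose rectangle meets `B` eventually coincide with those of `T`, then `T` is a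
`σ`-tiling. -/
theorem limit_of_tilings_is_tiling {A : Type} [Fintype A] (σ : A → List A)
    (lam : ℝ) (v : A → ℝ) (hEV : ExpandingEV σ lam v)
    (Tseq : ℕ → Set (A × ℝ × ℝ)) (T : Set (A × ℝ × ℝ))
    (hseq : ∀ m, IsTiling σ v lam (Tseq m))
    (hconv : ∀ B : Set (ℝ × ℝ), Bornology.IsBounded B → ∃ N, ∀ m, N ≤ m →
      {s ∈ Tseq m | (tileRect v lam s ∩ B).Nonempty} =
        {s ∈ T | (tileRect v lam s ∩ B).Nonempty}) :
    IsTiling σ v lam T := by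
  refine ⟨fun s hs u hu hne => ?_, fun p => ?_, fun s hs j => ?_⟩
  · obtain ⟨m, hsm, hum⟩ := exists_mem_iff_mem_pair hEV hconv s u
    exact (hseq m).disjoint s (hsm.mpr hs) u (hum.mpr hu) hne
  · obtain ⟨N, hN⟩ := hconv {p} Bornology.isBounded_singleton
    obtain ⟨s, hs, hps⟩ := (hseq N).covers p
    have hmem := (Set.ext_iff.mp (hN N le_rfl) s).mp ⟨hs, p, hps, rfl⟩
    exact ⟨s, hmem.1, hps⟩
  · obtain ⟨m, hsm, hum⟩ := exists_mem_iff_mem_pair hEV hconv s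
      ((σ s.1).get j,
        (s.2.1 + ((2 : ℝ) ^ s.2.2 / lam) * (((σ s.1).take (j : ℕ)).map v).sum,
          s.2.2 - Real.logb 2 lam))
    exact hum.mp ((hseq m).subst s (hsm.mpr hs) j)
end

section
/- Let σ be a substitution on a finite alphabet 𝒜 with expanding eigenvalue λ and positive eigenvector v, and assume log₂λ is irrational. Then no σ-tiling is invariant under a transformation of the form (x,y) ↦ (α + 2^β·x, β + y) with α ∈ ℝ and β a nonzero integer: for every σ-tiling T, every α ∈ ℝ and every β ∈ ℤ ∖ {0}, the set { (a, (α + 2^β·x, β + y)) : (a,(x,y)) ∈ T } is different from T. -/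
/-- A point below the total weight of a word lies in the half-open interval of one of its letters. -/
theorem exists_letter_of_lt_sum {A : Type} (v : A → ℝ) (L : List A) (t : ℝ) (ht : 0 ≤ t)
    (htL : t < (L.map v).sum) :
    ∃ j : Fin L.length, ((L.take (j : ℕ)).map v).sum ≤ t ∧
      t < ((L.take (j : ℕ)).map v).sum + v (L.get j) := by
  induction L generalizing t with
  | nil => simp at htL; linarith
  | cons a L ih =>
    rcases lt_or_ge t (v a) with h | h
    · exact ⟨⟨0, by simp⟩, by simpa using ht, by simpa using h⟩
    · simp only [List.map_cons, List.sum_cons] at htL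
      obtain ⟨j, hj₁, hj₂⟩ := ih (t - v a) (by linarith) (by linarith)
      refine ⟨j.succ, ?_, ?_⟩
      · simp only [Fin.val_succ, List.take_succ_cons, List.map_cons, List.sum_cons]
        linarith
      · simp only [Fin.val_succ, List.take_succ_cons, List.map_cons, List.sum_cons,
          List.get_cons_succ']
        linarith

/-- The half-open horizontal extent `[x, x + v(a)·2^y)` of a tile. -/
noncomputable def tileBase {A : Type} (v : A → ℝ) (s : A × ℝ × ℝ) : Set ℝ :=
  Set.Ico s.2.1 (s.2.1 + v s.1 * (2 : ℝ) ^ s.2.2)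

namespace IsTiling

variable {A : Type} {σ : A → List A} {v : A → ℝ} {lam : ℝ} {T : Set (A × ℝ × ℝ)}

/-- Two tiles whose rectangles overlap properly are equal. -/
theorem eq_of_overlap (hEV : ExpandingEV σ lam v) (hT : IsTiling σ v lam T)
    {s u : A × ℝ × ℝ} (hs : s ∈ T) (hu : u ∈ T)
    (hsu : s.2.1 < u.2.1 + v u.1 * (2 : ℝ) ^ u.2.2)
    (hus : u.2.1 < s.2.1 + v s.1 * (2 : ℝ) ^ s.2.2)
    (hy : |s.2.2 - u.2.2| < Real.logb 2 lam) : s = u := by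
  by_contra hne
  have hpos : ∀ w : A × ℝ × ℝ, 0 < v w.1 * (2 : ℝ) ^ w.2.2 := fun w =>
    mul_pos (hEV.2.1 _) (Real.rpow_pos_of_pos two_pos _)
  have hl : 0 < Real.logb 2 lam := Real.logb_pos one_lt_two hEV.1
  obtain ⟨hy₁, hy₂⟩ := abs_lt.mp hy
  obtain ⟨x, hx₁, hx₂⟩ := exists_between
    (show max s.2.1 u.2.1 <
        min (s.2.1 + v s.1 * (2 : ℝ) ^ s.2.2) (u.2.1 + v u.1 * (2 : ℝ) ^ u.2.2) from
      max_lt (lt_min (by linarith [hpos s]) hsu) (lt_min hus (by linarith [hpos u])))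
  obtain ⟨y, hy₃, hy₄⟩ := exists_between
    (show max (s.2.2 - Real.logb 2 lam) (u.2.2 - Real.logb 2 lam) < min s.2.2 u.2.2 from
      max_lt (lt_min (by linarith) (by linarith)) (lt_min (by linarith) (by linarith)))
  rw [max_lt_iff] at hx₁ hy₃
  rw [lt_min_iff] at hx₂ hy₄
  have hmem : (x, y) ∈ tileInterior v lam s ∩ tileInterior v lam u :=
    ⟨⟨⟨hx₁.1, hx₂.1⟩, ⟨hy₃.1, hy₄.1⟩⟩, ⟨⟨hx₁.2, hx₂.2⟩, ⟨hy₃.2, hy₄.2⟩⟩⟩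
  rw [hT.disjoint s hs u hu hne] at hmem
  exact hmem

/-- Below a tile over `z` there is, one level down, another tile over `z`. -/
theorem exists_below (hEV : ExpandingEV σ lam v) (hT : IsTiling σ v lam T)
    {s : A × ℝ × ℝ} (hs : s ∈ T) {z : ℝ} (hz : z ∈ tileBase v s) :
    ∃ u ∈ T, z ∈ tileBase v u ∧ u.2.2 = s.2.2 - Real.logb 2 lam := by
  have hlam : 0 < lam := zero_lt_one.trans hEV.1
  have hpow : (2 : ℝ) ^ (s.2.2 - Real.logb 2 lam) = (2 : ℝ) ^ s.2.2 / lam := by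
    rw [Real.rpow_sub two_pos, Real.rpow_logb two_pos (by norm_num) hlam]
  have hc : 0 < (2 : ℝ) ^ s.2.2 / lam := div_pos (Real.rpow_pos_of_pos two_pos _) hlam
  have hw : v s.1 * (2 : ℝ) ^ s.2.2 = lam * v s.1 * ((2 : ℝ) ^ s.2.2 / lam) := by
    field_simp
  obtain ⟨hz₁, hz₂⟩ := hz
  obtain ⟨j, hj₁, hj₂⟩ := exists_letter_of_lt_sum v (σ s.1)
    ((z - s.2.1) / ((2 : ℝ) ^ s.2.2 / lam)) (div_nonneg (by linarith) hc.le)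
    (by rw [← hEV.2.2, div_lt_iff₀ hc]; linarith)
  rw [le_div_iff₀ hc] at hj₁
  rw [div_lt_iff₀ hc] at hj₂
  refine ⟨_, hT.subst s hs j, ⟨?_, ?_⟩, rfl⟩
  · dsimp only
    linarith
  · dsimp only
    rw [hpow]
    linarith

theorem exists_below_iterate (hEV : ExpandingEV σ lam v) (hT : IsTiling σ v lam T)
    {s : A × ℝ × ℝ} (hs : s ∈ T) {z : ℝ} (hz : z ∈ tileBase v s) (k : ℕ) :
    ∃ u ∈ T, z ∈ tileBase v u ∧ u.2.2 = s.2.2 - k * Real.logb 2 lam := by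
  induction k with
  | zero => exact ⟨s, hs, hz, by simp⟩
  | succ k ih =>
    obtain ⟨u, hu, hzu, hy⟩ := ih
    obtain ⟨w, hw, hzw, hy'⟩ := hT.exists_below hEV hu hzu
    exact ⟨w, hw, hzw, by rw [hy', hy]; push_cast; ring⟩

/-- Heights of tiles over a common point differ by integer multiples of `log₂ λ`. -/
theorem exists_height_sub_eq (hEV : ExpandingEV σ lam v) (hT : IsTiling σ v lam T)
    {s u : A × ℝ × ℝ} (hs : s ∈ T) (hu : u ∈ T) {z : ℝ}
    (hzs : z ∈ tileBase v s) (hzu : z ∈ tileBase v u) :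
    ∃ k : ℤ, s.2.2 - u.2.2 = k * Real.logb 2 lam := by
  wlog h : u.2.2 ≤ s.2.2 generalizing s u
  · obtain ⟨k, hk⟩ := this hu hs hzu hzs (le_of_not_ge h)
    exact ⟨-k, by push_cast; linarith⟩
  have hl : 0 < Real.logb 2 lam := Real.logb_pos one_lt_two hEV.1
  have hq : 0 ≤ (s.2.2 - u.2.2) / Real.logb 2 lam := div_nonneg (by linarith) hl.le
  obtain ⟨w, hw, hzw, hy⟩ :=
    hT.exists_below_iterate hEV hs hzs ⌊(s.2.2 - u.2.2) / Real.logb 2 lam⌋₊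
  have h₁ := (le_div_iff₀ hl).mp (Nat.floor_le hq)
  have h₂ := (div_lt_iff₀ hl).mp (Nat.lt_floor_add_one ((s.2.2 - u.2.2) / Real.logb 2 lam))
  have hwu : w = u := hT.eq_of_overlap hEV hw hu (hzw.1.trans_lt hzu.2) (hzu.1.trans_lt hzw.2)
    (abs_lt.mpr ⟨by linarith, by linarith⟩)
  exact ⟨⌊(s.2.2 - u.2.2) / Real.logb 2 lam⌋₊, by rw [hwu] at hy; push_cast; linarith⟩

/-- Over every point of the line there is a tile whose half-open base contains it. -/
theorem exists_mem_tileBase [Fintype A] (hEV : ExpandingEV σ lam v) (hT : IsTiling σ v lam T)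
    (z : ℝ) : ∃ s ∈ T, z ∈ tileBase v s := by
  by_contra! hno
  have hl : 0 < Real.logb 2 lam := Real.logb_pos one_lt_two hEV.1
  have : Nonempty A := let ⟨s, _⟩ := hT.covers (0, 0); ⟨s.1⟩
  obtain ⟨a, ha⟩ := Finite.exists_min v
  have hright : ∀ ε > 0, ∀ y : ℝ, ∃ s ∈ T, z < s.2.1 ∧ s.2.1 ≤ z + ε ∧
      s.2.2 - Real.logb 2 lam ≤ y ∧ y ≤ s.2.2 := by
    intro ε hε y
    obtain ⟨s, hs, ⟨hx₁, hx₂⟩, hy₁, hy₂⟩ := hT.covers (z + ε, y)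
    dsimp only at hx₁ hx₂ hy₁ hy₂
    exact ⟨s, hs, not_le.mp fun hle => hno s hs ⟨hle, by linarith⟩, hx₁, hy₁, hy₂⟩
  have hwidth : ∀ s : A × ℝ × ℝ, -Real.logb 2 lam / 2 ≤ s.2.2 →
      v a * (2 : ℝ) ^ (-Real.logb 2 lam / 2) ≤ v s.1 * (2 : ℝ) ^ s.2.2 := fun s hy =>
    mul_le_mul (ha _) (Real.rpow_le_rpow_of_exponent_le one_le_two hy)
      (Real.rpow_pos_of_pos two_pos _).le (hEV.2.1 _).le
  have hm : 0 < v a * (2 : ℝ) ^ (-Real.logb 2 lam / 2) :=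
    mul_pos (hEV.2.1 _) (Real.rpow_pos_of_pos two_pos _)
  obtain ⟨s, hs, hzs, hsε, -, hy⟩ := hright _ hm 0
  obtain ⟨u, hu, hzu, huε, hyu₁, hyu₂⟩ :=
    hright ((s.2.1 - z) / 2) (by linarith) (s.2.2 - Real.logb 2 lam / 2)
  have hws := hwidth s (by linarith)
  have hwu := hwidth u (by linarith)
  have hsu : s = u := hT.eq_of_overlap hEV hs hu (by linarith) (by linarith)
    (abs_lt.mpr ⟨by linarith, by linarith⟩)
  rw [hsu] at huε hzs
  linarith

end IsTiling

/-- If `log₂ λ` is irrational then no `σ`-tiling is invariant under a transformation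
`(x,y) ↦ (α + 2^β·x, β + y)` with `β` a nonzero integer. -/
theorem tiling_not_invariant {A : Type} [Fintype A] (σ : A → List A)
    (lam : ℝ) (v : A → ℝ) (hEV : ExpandingEV σ lam v)
    (hirr : Irrational (Real.logb 2 lam))
    (T : Set (A × ℝ × ℝ)) (hT : IsTiling σ v lam T) (α : ℝ) (β : ℤ) (hβ : β ≠ 0) :
    {s : A × ℝ × ℝ | ∃ u ∈ T,
        s = (u.1, (α + (2 : ℝ) ^ (β : ℝ) * u.2.1, (β : ℝ) + u.2.2))} ≠ T := by
  intro hinv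
  have hc : 0 < (2 : ℝ) ^ (β : ℝ) := Real.rpow_pos_of_pos two_pos _
  have hβ' : (β : ℝ) ≠ 0 := Int.cast_ne_zero.mpr hβ
  have hc1 : 1 - (2 : ℝ) ^ (β : ℝ) ≠ 0 := by
    intro h
    have h' : (2 : ℝ) ^ (β : ℝ) = (2 : ℝ) ^ (0 : ℝ) := by rw [Real.rpow_zero]; linarith
    exact hβ' ((Real.rpow_right_inj two_pos (by norm_num)).mp h')
  obtain ⟨z, hz⟩ : ∃ z : ℝ, z = α + (2 : ℝ) ^ (β : ℝ) * z :=
    ⟨α / (1 - (2 : ℝ) ^ (β : ℝ)), by field_simp; ring⟩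
  obtain ⟨s, hs, hzs⟩ := hT.exists_mem_tileBase hEV z
  have hs' : (s.1, (α + (2 : ℝ) ^ (β : ℝ) * s.2.1, (β : ℝ) + s.2.2)) ∈ T :=
    hinv ▸ ⟨s, hs, rfl⟩
  have hzs' : z ∈ tileBase v (s.1, (α + (2 : ℝ) ^ (β : ℝ) * s.2.1, (β : ℝ) + s.2.2)) := by
    have h₁ := mul_le_mul_of_nonneg_left hzs.1 hc.le
    have h₂ := mul_lt_mul_of_pos_left hzs.2 hc
    refine ⟨?_, ?_⟩ <;> dsimp only
    · linarith
    · rw [Real.rpow_add two_pos]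
      linarith
  obtain ⟨k, hk⟩ := hT.exists_height_sub_eq hEV hs' hs hzs' hzs
  have hkβ : (β : ℝ) = k * Real.logb 2 lam := by simpa using hk
  have hk0 : k ≠ 0 := by
    rintro rfl
    simp [hβ] at hkβ
  exact (hirr.intCast_mul hk0).ne_int β hkβ.symm
end

section
/- For every integer n ≥ 2 there exist a finite alphabet R and a finite set F of patterns over BS(1,n) such that the subshift of finite type X_F ⊆ R^{BS(1,n)} is nonempty and strongly aperiodic. -/
/-- The shift action of `G` on configurations: `(𝔖_g x)_h = x_{g⁻¹h}`. -/
def shift {G R : Type} [Group G] (g : G) (x : G → R) : G → R := fun h => x (g⁻¹ * h)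

/-- The pattern `p` (with finite support `p.1`) appears in the configuration `x`. -/
def Appears {G R : Type} [Group G] (p : Finset G × (G → R)) (x : G → R) : Prop :=
  ∃ g : G, ∀ h ∈ p.1, x (g * h) = p.2 h

/-- The subshift `X_F` of configurations avoiding all patterns of `F`. -/
def XofF {G R : Type} [Group G] (F : Set (Finset G × (G → R))) : Set (G → R) :=
  {x | ∀ p ∈ F, ¬ Appears p x}

/-- A subshift is strongly aperiodic if every configuration has trivial stabilizer. -/
def StronglyAperiodic {G R : Type} [Group G] (X : Set (G → R)) : Prop :=
  ∀ x ∈ X, ∀ g : G, shift g x = x → g = 1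

section LocalRules

variable {G R : Type} [Group G]

/-- A translation-invariant condition read off a finite window defines an SFT. -/
theorem exists_finite_XofF_eq [Finite R] [Nonempty R] (W : Finset G) (P : (G → R) → Prop)
    (hP : ∀ x y : G → R, (∀ h ∈ W, x h = y h) → P x → P y) :
    ∃ F : Set (Finset G × (G → R)), F.Finite ∧ XofF F = {x | ∀ g, P fun h => x (g * h)} := by
  classical
  obtain ⟨r⟩ := ‹Nonempty R›
  let ext : (W → R) → G → R := fun w h => if hh : h ∈ W then w ⟨h, hh⟩ else r
  refine ⟨Set.image (fun w => (W, ext w)) {w | ¬ P (ext w)}, (Set.toFinite _).image _, ?_⟩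
  ext x
  constructor
  · intro hx g
    by_contra hg
    refine hx (W, ext fun h => x (g * h))
      ⟨fun h => x (g * h), fun h => hg (hP _ _ ?_ h), rfl⟩ ⟨g, ?_⟩
    · intro h hh
      simp [ext, hh]
    · intro h hh
      have hh' : h ∈ W := hh
      simp [ext, hh']
  · rintro hx _ ⟨w, hw, rfl⟩ ⟨g, hg⟩
    exact hw (hP _ _ hg (hx g))

/-- An element of the stabilizer of `x` is a left period of `x`. -/
theorem apply_mul_of_shift_eq {x : G → R} {g : G} (hg : shift g x = x) (h : G) :
    x (g * h) = x h := by
  have := congrFun hg (g * h)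
  simpa [shift] using this.symm

end LocalRules

section BaumslagSolitar

variable (n : ℕ)

theorem BSt_inv_mul_BSa_mul_BSt : (BSt n)⁻¹ * BSa n * BSt n = BSa n ^ n := by
  have h : (PresentedGroup.mk (BSrel n)) ((FreeGroup.of BSgen.t)⁻¹ * FreeGroup.of BSgen.a *
      FreeGroup.of BSgen.t * ((FreeGroup.of BSgen.a) ^ n)⁻¹) = 1 :=
    PresentedGroup.one_of_mem rfl
  simp only [map_mul, map_inv, map_pow, mul_inv_eq_one] at h
  exact h

theorem BSa_zpow_mul_BSt (k : ℤ) : BSa n ^ k * BSt n = BSt n * BSa n ^ (n * k) := by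
  have h : (BSt n)⁻¹ * BSa n ^ k * BSt n = BSa n ^ (n * k) := by
    rw [zpow_mul, zpow_natCast, ← BSt_inv_mul_BSa_mul_BSt]
    have := conj_zpow (i := k) (a := (BSt n)⁻¹) (b := BSa n)
    simpa using this.symm
  rw [← h]
  group

theorem BSa_zpow_mul_BSt_inv (k : ℤ) :
    BSa n ^ (n * k) * (BSt n)⁻¹ = (BSt n)⁻¹ * BSa n ^ k := by
  rw [mul_inv_eq_iff_eq_mul, mul_assoc, BSa_zpow_mul_BSt, inv_mul_cancel_left]

theorem BSa_zpow_mul_BSt_pow (k : ℤ) (i : ℕ) :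
    BSa n ^ k * BSt n ^ i = BSt n ^ i * BSa n ^ ((n : ℤ) ^ i * k) := by
  induction i with
  | zero => simp
  | succ i ih =>
    rw [pow_succ, ← mul_assoc, ih, mul_assoc, BSa_zpow_mul_BSt, ← mul_assoc]
    congr 2
    ring

/-- Every element of `BS(1,n)` is of the form `tⁱ·aᵏ·t⁻ʲ`. -/
theorem BS_exists_normal_form (g : BS n) :
    ∃ (i j : ℕ) (k : ℤ), g = BSt n ^ i * BSa n ^ k * (BSt n ^ j)⁻¹ := by
  have hg : g ∈ Subgroup.closure (Set.range (PresentedGroup.of (rels := BSrel n))) := by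
    simp
  have ha (e : ℤ) (y : BS n) :
      (∃ (i j : ℕ) (k : ℤ), y = BSt n ^ i * BSa n ^ k * (BSt n ^ j)⁻¹) →
      ∃ (i j : ℕ) (k : ℤ), BSa n ^ e * y = BSt n ^ i * BSa n ^ k * (BSt n ^ j)⁻¹ := by
    rintro ⟨i, j, k, rfl⟩
    refine ⟨i, j, (n : ℤ) ^ i * e + k, ?_⟩
    rw [← mul_assoc, ← mul_assoc, BSa_zpow_mul_BSt_pow, zpow_add, mul_assoc (BSt n ^ i)]
  induction hg using Subgroup.closure_induction_left with
  | one => exact ⟨0, 0, 0, by simp⟩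
  | mul_left s hs y _ ih =>
    obtain ⟨_ | _, rfl⟩ := hs
    · simpa [BSa] using ha 1 y ih
    · obtain ⟨i, j, k, rfl⟩ := ih
      refine ⟨i + 1, j, k, ?_⟩
      rw [pow_succ']
      simp only [mul_assoc, BSt]
  | inv_mul_cancel s hs y _ ih =>
    obtain ⟨_ | _, rfl⟩ := hs
    · simpa [BSa] using ha (-1) y ih
    · obtain ⟨_ | i, j, k, rfl⟩ := ih
      · refine ⟨0, j + 1, n * k, ?_⟩
        rw [pow_succ, mul_inv_rev, pow_zero, one_mul, one_mul, ← mul_assoc, ← mul_assoc,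
          BSa_zpow_mul_BSt_inv]
        rfl
      · refine ⟨i, j, k, ?_⟩
        rw [pow_succ']
        change (BSt n)⁻¹ * _ = _
        simp only [mul_assoc, inv_mul_cancel_left]

end BaumslagSolitar

section AlmostScaling

/-- Moving a window of summation changes a sum of terms in `[1, 6]` by a bounded amount. -/
theorem abs_sum_window_sub_le {f : ℤ → ℤ} (hf : ∀ l, 1 ≤ f l ∧ f l ≤ 6) (N : ℕ) (k : ℤ) :
    |∑ l ∈ Finset.range N, f (k + l) - ∑ l ∈ Finset.range N, f l| ≤ 6 * |k| := by
  have step (k : ℤ) :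
      |∑ l ∈ Finset.range N, f (k + 1 + l) - ∑ l ∈ Finset.range N, f (k + l)| ≤ 6 := by
    have h1 := Finset.sum_range_succ (fun l : ℕ => f (k + l)) N
    have h2 := Finset.sum_range_succ' (fun l : ℕ => f (k + l)) N
    have h3 : ∑ l ∈ Finset.range N, f (k + ((l + 1 : ℕ) : ℤ)) =
        ∑ l ∈ Finset.range N, f (k + 1 + l) :=
      Finset.sum_congr rfl fun l _ => by congr 1; push_cast; ring
    rw [h3] at h2
    have h4 := hf (k + N)
    have h5 := hf (k + (0 : ℕ))
    rw [abs_le]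
    constructor <;> linarith
  induction k using Int.induction_on with
  | zero => simp
  | succ k ih =>
    have := abs_le.1 (step k)
    rw [abs_of_nonneg (a := (k : ℤ)) (by positivity), abs_le] at ih
    rw [abs_of_nonneg (a := (k : ℤ) + 1) (by positivity), abs_le]
    constructor <;> linarith
  | pred k ih =>
    have := step (-(k : ℤ) - 1)
    rw [sub_add_cancel, abs_le] at this
    rw [abs_of_nonpos (a := -(k : ℤ)) (by omega), abs_le] at ih
    rw [abs_of_nonpos (a := -(k : ℤ) - 1) (by omega), abs_le]
    constructor <;> linarith

/-- A function of linear growth satisfying `p·S(KN) = K·q·S(N) + O(1)` has `p = q`. -/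
theorem eq_of_almost_scaling {S : ℕ → ℤ} (hS : ∀ N : ℕ, (N : ℤ) ≤ S N ∧ S N ≤ 6 * N)
    {K : ℕ} (hK : 2 ≤ K) {p q : ℕ} (hp : 1 ≤ p) {B : ℤ}
    (h : ∀ N, |p * S (K * N) - K * q * S N| ≤ B) : p = q := by
  by_contra hpq
  have hK0 : (0 : ℝ) < K := by positivity
  let A : ℕ → ℝ := fun i => S (K ^ i) / (K : ℝ) ^ i
  have hA (i : ℕ) : 1 ≤ A i ∧ A i ≤ 6 := by
    have := hS (K ^ i)
    constructor
    · rw [one_le_div (by positivity)]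
      exact_mod_cast this.1
    · rw [div_le_iff₀ (by positivity)]
      exact_mod_cast this.2
  have hstep (i : ℕ) : |p * A (i + 1) - q * A i| ≤ B / (K : ℝ) ^ i := by
    have h1 := h (K ^ i)
    have h2 : |(p : ℝ) * S (K * K ^ i) - K * q * S (K ^ i)| ≤ B := by exact_mod_cast h1
    have h3 : p * A (i + 1) - q * A i =
        (p * S (K * K ^ i) - K * q * S (K ^ i)) / (K : ℝ) ^ (i + 1) := by
      simp only [A, pow_succ']
      field_simp
    have hB : (0 : ℝ) ≤ B := (abs_nonneg _).trans h2
    rw [h3, abs_div, abs_of_pos (show (0 : ℝ) < (K : ℝ) ^ (i + 1) by positivity)]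
    have h5 : (K : ℝ) ^ i ≤ (K : ℝ) ^ (i + 1) :=
      pow_le_pow_right₀ (by exact_mod_cast (by omega : 1 ≤ K)) (by omega)
    gcongr
  obtain ⟨i₀, hi₀⟩ : ∃ i₀ : ℕ, ∀ i ≥ i₀, B / (K : ℝ) ^ i ≤ 1 / 2 := by
    have := (tendsto_pow_atTop_nhds_zero_of_lt_one (r := (K : ℝ)⁻¹) (by positivity)
      (inv_lt_one_of_one_lt₀ (by exact_mod_cast hK))).const_mul (B : ℝ)
    rw [mul_zero] at this
    obtain ⟨i₀, hi₀⟩ := Filter.eventually_atTop.1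
      (this.eventually_le_const (u := 1 / 2) (by norm_num))
    exact ⟨i₀, fun i hi => by simpa [div_eq_mul_inv] using hi₀ i hi⟩
  have hp0 : (1 : ℝ) ≤ p := by exact_mod_cast hp
  rcases lt_or_gt_of_ne hpq with hlt | hlt
  · have hlt' : (p : ℝ) + 1 ≤ q := by exact_mod_cast hlt
    have hgrow (j : ℕ) : p * A i₀ + j / 2 ≤ p * A (i₀ + j) := by
      induction j with
      | zero => simp
      | succ j ih =>
        have h1 := (abs_le.1 (hstep (i₀ + j))).1
        have h2 := hi₀ (i₀ + j) (by omega)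
        have h3 := hA (i₀ + j)
        rw [← add_assoc]
        push_cast
        nlinarith
    have h1 := hgrow (12 * p)
    have h2 := hA i₀
    have h3 := hA (i₀ + 12 * p)
    push_cast at h1
    nlinarith
  · have hlt' : (q : ℝ) + 1 ≤ p := by exact_mod_cast hlt
    have hdrop (j : ℕ) : p * A (i₀ + j) + j / 2 ≤ p * A i₀ := by
      induction j with
      | zero => simp
      | succ j ih =>
        have h1 := (abs_le.1 (hstep (i₀ + j))).2
        have h2 := hi₀ (i₀ + j) (by omega)
        have h3 := hA (i₀ + j)
        rw [← add_assoc]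
        push_cast
        nlinarith
    have h1 := hdrop (12 * p)
    have h2 := hA i₀
    have h3 := hA (i₀ + 12 * p)
    push_cast at h1
    nlinarith

end AlmostScaling

section Tiles

/-- The alphabet: a digit, a carry, a multiplier flag and a position modulo `n`. -/
structure Tile (n : ℕ) : Type where
  /-- The digit, whose averages along rows are multiplied by `2` or `1/3` from row to row. -/
  digit : Set.Icc (1 : ℤ) 6
  /-- The carry, scaled by `3n`. -/
  carry : Set.Icc (-3 : ℤ) (6 * n)
  /-- Whether the multiplier to the next row is `2` or `1/3`. -/
  doubling : Bool
  /-- The position in the row modulo `n`. -/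
  pos : ZMod n

/-- Three times the multiplier to the next row. -/
def Tile.factor {n : ℕ} (τ : Tile n) : ℕ := if τ.doubling then 6 else 1

instance (n : ℕ) [NeZero n] : Finite (Tile n) :=
  Finite.of_injective
    (fun τ : Tile n => (τ.digit, τ.carry, τ.doubling, τ.pos)) (by
      rintro ⟨⟩ ⟨⟩ h
      simpa using h)

instance (n : ℕ) : Nonempty (Tile n) :=
  ⟨⟨⟨1, by simp⟩, ⟨0, by simp⟩, true, 0⟩⟩

/-- The local rule at the identity. -/
structure TileRule (n : ℕ) (x : BS n → Tile n) : Prop where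
  pos_eq : (x (BSa n)).pos = (x 1).pos + 1
  doubling_eq : (x (BSa n)).doubling = (x 1).doubling
  sum_digit_eq : 3 * ∑ i ∈ Finset.range n, ((x (BSt n * BSa n ^ i)).digit : ℤ) =
    n * (x 1).factor * (x 1).digit + (x (BSa n)).carry - (x 1).carry

/-- The window of the local rule. -/
noncomputable def tileWindow (n : ℕ) : Finset (BS n) :=
  open Classical in
  {1, BSa n} ∪ (Finset.range n).image fun i => BSt n * BSa n ^ i

theorem TileRule.congr {n : ℕ} {x y : BS n → Tile n} (h : ∀ g ∈ tileWindow n, x g = y g)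
    (hx : TileRule n x) : TileRule n y := by
  have h1 : x 1 = y 1 := h _ (by simp [tileWindow])
  have ha : x (BSa n) = y (BSa n) := h _ (by simp [tileWindow])
  have hs : ∑ i ∈ Finset.range n, ((x (BSt n * BSa n ^ i)).digit : ℤ) =
      ∑ i ∈ Finset.range n, ((y (BSt n * BSa n ^ i)).digit : ℤ) :=
    Finset.sum_congr rfl fun i hi => by
      have hmem : BSt n * BSa n ^ i ∈ tileWindow n := by
        simp only [tileWindow, Finset.mem_union, Finset.mem_image]
        exact Or.inr ⟨i, hi, rfl⟩
      rw [h _ hmem]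
  refine ⟨?_, ?_, ?_⟩
  · rw [← h1, ← ha, hx.pos_eq]
  · rw [← h1, ← ha, hx.doubling_eq]
  · rw [← hs, ← h1, ← ha, hx.sum_digit_eq]

/-- The configurations satisfying the local rule everywhere. -/
def IsTiling_s16 (n : ℕ) (x : BS n → Tile n) : Prop := ∀ g, TileRule n fun h => x (g * h)

end Tiles

section Aperiodicity

variable {n : ℕ} {x : BS n → Tile n}

theorem IsTiling_s16.pos_mul_zpow (hx : IsTiling_s16 n x) (b : BS n) (k : ℤ) :
    (x (b * BSa n ^ k)).pos = (x b).pos + k := by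
  have step (g : BS n) : (x (g * BSa n)).pos = (x g).pos + 1 := by
    simpa using (hx g).pos_eq
  induction k using Int.induction_on with
  | zero => simp
  | succ k ih =>
    rw [zpow_add_one, ← mul_assoc, step, ih]
    push_cast
    ring
  | pred k ih =>
    have := step (b * BSa n ^ (-(k : ℤ) - 1))
    rw [mul_assoc, ← zpow_add_one, sub_add_cancel, ih] at this
    push_cast at this ⊢
    linear_combination -this

/-- No power of `a` is a period of a translate of a tiling. -/
theorem IsTiling_s16.eq_zero_of_period (hx : IsTiling_s16 n x) (hn : 2 ≤ n) (b : BS n) (k : ℤ)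
    (h : ∀ g, x (b * BSa n ^ k * g) = x (b * g)) : k = 0 := by
  have hdvd (m : ℕ) : ∀ (b : BS n) (k : ℤ),
      (∀ g, x (b * BSa n ^ k * g) = x (b * g)) → (n : ℤ) ^ m ∣ k := by
    induction m with
    | zero => simp
    | succ m ih =>
      intro b k h
      have h1 := hx.pos_mul_zpow b k
      have h2 := h 1
      rw [mul_one, mul_one] at h2
      rw [h2, left_eq_add, ZMod.intCast_zmod_eq_zero_iff_dvd] at h1
      obtain ⟨l, rfl⟩ := h1
      rw [pow_succ']
      refine mul_dvd_mul_left _ (ih (b * (BSt n)⁻¹) l fun g => ?_)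
      have h3 := h ((BSt n)⁻¹ * g)
      rwa [← mul_assoc, mul_assoc b, BSa_zpow_mul_BSt_inv, ← mul_assoc, ← mul_assoc] at h3
  by_contra hk
  have h1 := Int.le_of_dvd (abs_pos.2 hk) ((dvd_abs _ _).2 (hdvd k.natAbs b k h))
  have h2 : k.natAbs < n ^ k.natAbs := Nat.lt_pow_self (by omega)
  rw [Int.abs_eq_natAbs] at h1
  have h3 : ((n ^ k.natAbs : ℕ) : ℤ) ≤ k.natAbs := by exact_mod_cast h1
  omega

theorem IsTiling_s16.factor_mul_pow (hx : IsTiling_s16 n x) (b : BS n) (l : ℕ) :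
    (x (b * BSa n ^ l)).factor = (x b).factor := by
  induction l with
  | zero => simp
  | succ l ih =>
    rw [← ih, pow_succ, ← mul_assoc]
    have := (hx (b * BSa n ^ l)).doubling_eq
    simp only [mul_one] at this
    simp only [Tile.factor, this]

/-- The sum of the `N` digits of a row following a given position. -/
def digitSum (x : BS n → Tile n) (b : BS n) (N : ℕ) : ℤ :=
  ∑ l ∈ Finset.range N, ((x (b * BSa n ^ l)).digit : ℤ)

theorem le_digitSum_and_digitSum_le (x : BS n → Tile n) (b : BS n) (N : ℕ) :
    (N : ℤ) ≤ digitSum x b N ∧ digitSum x b N ≤ 6 * N := by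
  constructor
  · have := Finset.card_nsmul_le_sum (Finset.range N)
      (fun l => ((x (b * BSa n ^ l)).digit : ℤ)) 1 fun l _ => (x (b * BSa n ^ l)).digit.2.1
    simpa [digitSum] using this
  · have := Finset.sum_le_card_nsmul (Finset.range N)
      (fun l => ((x (b * BSa n ^ l)).digit : ℤ)) 6 fun l _ => (x (b * BSa n ^ l)).digit.2.2
    simpa [digitSum, mul_comm] using this

theorem digitSum_add (x : BS n → Tile n) (b : BS n) (M N : ℕ) :
    digitSum x b (M + N) = digitSum x b M + digitSum x (b * BSa n ^ M) N := by
  simp [digitSum, Finset.sum_range_add, pow_add, mul_assoc]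

theorem IsTiling_s16.digitSum_next_row (hx : IsTiling_s16 n x) (b : BS n) (N : ℕ) :
    3 * digitSum x (b * BSt n) (n * N) =
      n * (x b).factor * digitSum x b N + (x (b * BSa n ^ N)).carry - (x b).carry := by
  induction N with
  | zero => simp [digitSum]
  | succ N ih =>
    have hrow : b * BSt n * BSa n ^ (n * N) = b * BSa n ^ N * BSt n := by
      have := BSa_zpow_mul_BSt n N
      rw [mul_assoc b, mul_assoc b, ← zpow_natCast, ← zpow_natCast, this]
      push_cast
      rfl
    have h1 := (hx (b * BSa n ^ N)).sum_digit_eq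
    simp only [mul_one, hx.factor_mul_pow] at h1
    rw [mul_add_one, digitSum_add, hrow, mul_add, ih, digitSum_add x b N 1, pow_succ, ← mul_assoc b]
    simp only [digitSum, Finset.sum_range_one, pow_zero, mul_one]
    simp only [← mul_assoc] at h1 ⊢
    rw [h1]
    ring

/-- The averages of the digits are multiplied by a power of `6` over a power of `3` between rows. -/
theorem IsTiling_s16.exists_digitSum_scaling (hx : IsTiling_s16 n x) (b : BS n) (m : ℕ) :
    ∃ (e : ℕ) (B : ℤ), ∀ N, |((3 ^ m : ℕ) : ℤ) * digitSum x (b * BSt n ^ m) (n ^ m * N) -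
      (n ^ m : ℕ) * (6 ^ e : ℕ) * digitSum x b N| ≤ B := by
  induction m with
  | zero => exact ⟨0, 0, fun N => by simp⟩
  | succ m ih =>
    obtain ⟨e, B, hB⟩ := ih
    obtain ⟨e', he'⟩ : ∃ e', (x (b * BSt n ^ m)).factor = 6 ^ e' := by
      unfold Tile.factor
      split_ifs
      exacts [⟨1, rfl⟩, ⟨0, rfl⟩]
    refine ⟨e + e', 3 ^ m * (6 * n + 3) + n * 6 ^ e' * B, fun N => ?_⟩
    have h1 := hx.digitSum_next_row (b * BSt n ^ m) (n ^ m * N)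
    rw [he', ← mul_assoc n, ← pow_succ', mul_assoc b, ← pow_succ] at h1
    set c := (x (b * BSt n ^ m * BSa n ^ (n ^ m * N))).carry
    set c' := (x (b * BSt n ^ m)).carry
    have hc : |(c : ℤ) - c'| ≤ 6 * n + 3 := by
      have := c.2
      have := c'.2
      simp only [Set.mem_Icc] at *
      rw [abs_le]
      constructor <;> linarith
    set S := digitSum x (b * BSt n ^ m) (n ^ m * N)
    have key : ((3 ^ (m + 1) : ℕ) : ℤ) * digitSum x (b * BSt n ^ (m + 1)) (n ^ (m + 1) * N) -
        (n ^ (m + 1) : ℕ) * (6 ^ (e + e') : ℕ) * digitSum x b N =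
        3 ^ m * ((c : ℤ) - c') + n * 6 ^ e' *
          (((3 ^ m : ℕ) : ℤ) * S - (n ^ m : ℕ) * (6 ^ e : ℕ) * digitSum x b N) := by
      push_cast at h1 ⊢
      linear_combination 3 ^ m * h1
    rw [key]
    refine (abs_add_le _ _).trans (add_le_add ?_ ?_)
    · rw [abs_mul, abs_of_nonneg (by positivity)]
      gcongr
    · rw [abs_mul, abs_of_nonneg (by positivity)]
      gcongr
      exact hB N

/-- No element `tᵐ·aᵏ` with `m ≥ 1` is a period of a translate of a tiling. -/
theorem IsTiling_s16.eq_zero_of_height_period (hx : IsTiling_s16 n x) (hn : 2 ≤ n) (b : BS n) (m : ℕ)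
    (k : ℤ) (h : ∀ g, x (b * BSt n ^ m * BSa n ^ k * g) = x (b * g)) : m = 0 := by
  by_contra hm
  obtain ⟨e, B, hB⟩ := hx.exists_digitSum_scaling b m
  have hshift (N : ℕ) : |digitSum x b N - digitSum x (b * BSt n ^ m) N| ≤ 6 * |k| := by
    have := abs_sum_window_sub_le (f := fun l => ((x (b * BSt n ^ m * BSa n ^ l)).digit : ℤ))
      (fun l => (x (b * BSt n ^ m * BSa n ^ l)).digit.2) N k
    have h2 : ∑ l ∈ Finset.range N, ((x (b * BSt n ^ m * BSa n ^ (k + (l : ℤ)))).digit : ℤ) =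
        digitSum x b N :=
      Finset.sum_congr rfl fun l _ => by rw [zpow_add, ← mul_assoc, h, zpow_natCast]
    simpa only [h2, zpow_natCast, digitSum] using this
  have hscale : 3 ^ m = 6 ^ e := by
    refine eq_of_almost_scaling (S := digitSum x b) (le_digitSum_and_digitSum_le x b)
      (K := n ^ m) (hn.trans (Nat.le_self_pow hm n)) (Nat.one_le_pow _ _ (by norm_num))
      (B := 3 ^ m * (6 * |k|) + B) fun N => ?_
    have key : ((3 ^ m : ℕ) : ℤ) * digitSum x b (n ^ m * N) -
        (n ^ m : ℕ) * (6 ^ e : ℕ) * digitSum x b N =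
        3 ^ m * (digitSum x b (n ^ m * N) - digitSum x (b * BSt n ^ m) (n ^ m * N)) +
        (((3 ^ m : ℕ) : ℤ) * digitSum x (b * BSt n ^ m) (n ^ m * N) -
          (n ^ m : ℕ) * (6 ^ e : ℕ) * digitSum x b N) := by
      push_cast
      ring
    rw [key]
    refine (abs_add_le _ _).trans (add_le_add ?_ (hB N))
    rw [abs_mul, abs_of_nonneg (by positivity)]
    gcongr
    exact hshift _
  rcases Nat.eq_zero_or_pos e with rfl | he
  · exact hm (by simpa using hscale)
  · have h1 : Even (6 ^ e) := Even.pow_of_ne_zero (by decide) he.ne'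
    have h2 : Odd (3 ^ m) := Odd.pow (by decide)
    rw [hscale] at h2
    exact (Nat.not_even_iff_odd.2 h2) h1

/-- The stabilizer of a tiling is trivial. -/
theorem IsTiling_s16.eq_one_of_period (hx : IsTiling_s16 n x) (hn : 2 ≤ n) (g : BS n)
    (hg : ∀ h, x (g * h) = x h) : g = 1 := by
  have height_le (i j : ℕ) (k : ℤ)
      (h : ∀ h, x (BSt n ^ i * BSa n ^ k * (BSt n ^ j)⁻¹ * h) = x h) : i ≤ j := by
    by_contra! hij
    obtain ⟨m, rfl⟩ := Nat.exists_eq_add_of_le hij.le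
    have := hx.eq_zero_of_height_period hn (BSt n ^ j) m k fun y => by
      rw [← h (BSt n ^ j * y), ← mul_assoc _ (BSt n ^ j), inv_mul_cancel_right, pow_add]
    omega
  obtain ⟨i, j, k, rfl⟩ := BS_exists_normal_form n g
  obtain rfl : i = j := by
    refine le_antisymm (height_le i j k hg) (height_le j i (-k) fun y => ?_)
    rw [← hg]
    congr 1
    group
  have hk := hx.eq_zero_of_period hn (BSt n ^ i) k fun y => by
    rw [← hg (BSt n ^ i * y), ← mul_assoc _ (BSt n ^ i), inv_mul_cancel_right]
  simp [hk]

end Aperiodicity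

section Existence

/-- The bijection of `[1, 6)` doubling the numbers below `3` and dividing the others by `3`. -/
def doubleOrThird : Equiv.Perm (Set.Ico (1 : ℚ) 6) where
  toFun r := if h : r.1 < 3
    then ⟨2 * r.1, by constructor <;> linarith [r.2.1]⟩
    else ⟨r.1 / 3, by constructor <;> linarith [r.2.2]⟩
  invFun r := if h : r.1 < 2
    then ⟨3 * r.1, by constructor <;> linarith [r.2.1]⟩
    else ⟨r.1 / 2, by constructor <;> linarith [r.2.2]⟩
  left_inv r := by
    have h1 := r.2.1
    have h2 := r.2.2
    by_cases h : r.1 < 3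
    · have : ¬ (2 * r.1 < 2) := by linarith
      ext
      simp [h, this]
    · have : r.1 / 3 < 2 := by linarith
      ext
      simp only [h, this, dif_pos, dif_neg, not_false_eq_true]
      ring
  right_inv r := by
    have h1 := r.2.1
    have h2 := r.2.2
    by_cases h : r.1 < 2
    · have : ¬ (3 * r.1 < 3) := by linarith
      ext
      simp [h, this]
    · have : r.1 / 2 < 3 := by linarith
      ext
      simp only [h, this, dif_pos, dif_neg, not_false_eq_true]
      ring

theorem three_mul_doubleOrThird (r : Set.Ico (1 : ℚ) 6) :
    3 * (doubleOrThird r : ℚ) = (if (r : ℚ) < 3 then 6 else 1 : ℕ) * r := by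
  simp only [doubleOrThird, Equiv.coe_fn_mk]
  split_ifs
  · push_cast
    ring
  · push_cast
    ring

/-- A slope for each row of `BS(1,n)` and a position for each element, compatible with right
multiplication by the generators. -/
theorem exists_slope_position {n : ℕ} (hn : n ≠ 0) :
    ∃ (slope : BS n → Set.Ico (1 : ℚ) 6) (p : BS n → ℚ),
      (∀ g, slope (g * BSa n) = slope g) ∧ (∀ g, p (g * BSa n) = p g + 1) ∧
      (∀ g, slope (g * BSt n) = doubleOrThird (slope g)) ∧ ∀ g, p (g * BSt n) = n * p g := by
  let A : Equiv.Perm (Set.Ico (1 : ℚ) 6 × ℚ) := (Equiv.refl _).prodCongr (Equiv.addRight 1)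
  let T : Equiv.Perm (Set.Ico (1 : ℚ) 6 × ℚ) :=
    doubleOrThird.prodCongr (Equiv.mulLeft₀ (n : ℚ) (by exact_mod_cast hn))
  have hA (m : ℕ) (s : Set.Ico (1 : ℚ) 6 × ℚ) : (A ^ m) s = (s.1, s.2 + m) := by
    induction m with
    | zero => simp
    | succ m ih =>
      rw [pow_succ', Equiv.Perm.mul_apply, ih]
      simp [A, add_assoc]
  have hTA : T * A = A ^ n * T := by
    ext1 s
    rw [Equiv.Perm.mul_apply, Equiv.Perm.mul_apply, hA]
    ext <;> simp [A, T, mul_add]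
  let gen : BSgen → Equiv.Perm (Set.Ico (1 : ℚ) 6 × ℚ) := fun s => BSgen.casesOn s A⁻¹ T⁻¹
  have hrel : ∀ r ∈ BSrel n, FreeGroup.lift gen r = 1 := by
    rintro _ rfl
    have : (T⁻¹)⁻¹ * A⁻¹ * T⁻¹ = (A⁻¹) ^ n := by
      rw [inv_inv, inv_pow, mul_inv_eq_iff_eq_mul, eq_inv_mul_iff_mul_eq, ← mul_assoc, ← hTA,
        mul_inv_cancel_right]
    simp [gen] at this ⊢
    rw [this, inv_mul_cancel]
  let φ := PresentedGroup.toGroup hrel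
  have ha : φ (BSa n) = A⁻¹ := PresentedGroup.toGroup.of hrel
  have ht : φ (BSt n) = T⁻¹ := PresentedGroup.toGroup.of hrel
  let s₀ : Set.Ico (1 : ℚ) 6 × ℚ := (⟨1, by norm_num⟩, 0)
  refine ⟨fun g => ((φ g)⁻¹ s₀).1, fun g => ((φ g)⁻¹ s₀).2, ?_, ?_, ?_, ?_⟩ <;> intro g <;>
    simp [map_mul, ha, ht, A, T]

theorem exists_isTiling {n : ℕ} (hn : n ≠ 0) : ∃ x, IsTiling_s16 n x := by
  obtain ⟨slope, p, slope_a, p_a, slope_t, p_t⟩ := exists_slope_position hn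
  let c : BS n → ℕ := fun g => if (slope g : ℚ) < 3 then 6 else 1
  have hc1 (g : BS n) : (c g : ℚ) ≤ 6 := by
    simp only [c]
    split_ifs <;> norm_num
  have hslope (g : BS n) : 3 * (slope (g * BSt n) : ℚ) = c g * slope g := by
    rw [slope_t]
    exact three_mul_doubleOrThird _
  let digit : BS n → ℤ := fun g => ⌊(p g + 1) * slope g⌋ - ⌊p g * slope g⌋
  let carry : BS n → ℤ := fun g =>
    3 * ⌊n * p g * slope (g * BSt n)⌋ - n * c g * ⌊p g * slope g⌋
  have hdigit (g : BS n) : digit g ∈ Set.Icc (1 : ℤ) 6 := by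
    have h1 := (slope g).2.1
    have h2 := (slope g).2.2
    have h3 : (p g + 1) * (slope g : ℚ) = p g * slope g + slope g := by ring
    constructor
    · have : ⌊p g * (slope g : ℚ)⌋ + 1 ≤ ⌊(p g + 1) * (slope g : ℚ)⌋ := by
        rw [← Int.floor_add_one, h3]
        exact Int.floor_mono (by linarith)
      simp only [digit]
      linarith
    · have : ⌊(p g + 1) * (slope g : ℚ)⌋ ≤ ⌊p g * (slope g : ℚ)⌋ + 6 := by
        have h4 : ⌊p g * (slope g : ℚ)⌋ + 6 = ⌊p g * (slope g : ℚ) + 6⌋ := by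
          exact_mod_cast (Int.floor_add_intCast (p g * (slope g : ℚ)) 6).symm
        rw [h4, h3]
        exact Int.floor_mono (by linarith)
      simp only [digit]
      linarith
  have hcarry (g : BS n) : carry g ∈ Set.Icc (-3 : ℤ) (6 * n) := by
    have h1 := Int.floor_le (p g * (slope g : ℚ))
    have h2 := Int.lt_floor_add_one (p g * (slope g : ℚ))
    have h3 := Int.floor_le (n * p g * (slope (g * BSt n) : ℚ))
    have h4 := Int.lt_floor_add_one (n * p g * (slope (g * BSt n) : ℚ))
    have h5 : 3 * (n * p g * (slope (g * BSt n) : ℚ)) = n * c g * (p g * slope g) := by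
      linear_combination n * p g * hslope g
    have h6 : (0 : ℚ) ≤ n * c g := by positivity
    have h7 : (n : ℚ) * c g ≤ n * 6 := by
      gcongr
      exact hc1 g
    have h8 : (carry g : ℚ) = 3 * ⌊n * p g * (slope (g * BSt n) : ℚ)⌋ -
        n * c g * ⌊p g * (slope g : ℚ)⌋ := by
      simp [carry]
    have h9 : (-3 : ℚ) ≤ carry g := by
      rw [h8]
      nlinarith
    have h10 : (carry g : ℚ) ≤ 6 * n := by
      rw [h8]
      nlinarith
    exact ⟨by exact_mod_cast h9, by exact_mod_cast h10⟩
  refine ⟨fun g => ⟨⟨digit g, hdigit g⟩, ⟨carry g, hcarry g⟩,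
    decide ((slope g : ℚ) < 3), (⌊p g⌋ : ℤ)⟩, fun g => ⟨?_, ?_, ?_⟩⟩
  · simp [p_a]
  · simp [slope_a]
  · have hpow (m : ℕ) : slope (g * (BSt n * BSa n ^ m)) = slope (g * BSt n) ∧
        p (g * (BSt n * BSa n ^ m)) = n * p g + m := by
      induction m with
      | zero => simp [p_t]
      | succ m ih =>
        rw [pow_succ, ← mul_assoc, ← mul_assoc, slope_a, p_a, mul_assoc, ih.1, ih.2]
        simp [add_assoc]
    have hsum : ∑ i ∈ Finset.range n, digit (g * (BSt n * BSa n ^ i)) =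
        ⌊n * (p g + 1) * (slope (g * BSt n) : ℚ)⌋ - ⌊n * p g * (slope (g * BSt n) : ℚ)⌋ := by
      have h1 (i : ℕ) : digit (g * (BSt n * BSa n ^ i)) =
          ⌊(n * p g + (i + 1 : ℕ)) * (slope (g * BSt n) : ℚ)⌋ -
            ⌊(n * p g + i) * (slope (g * BSt n) : ℚ)⌋ := by
        simp only [digit, hpow]
        push_cast
        rw [add_assoc]
      simp only [h1]
      rw [Finset.sum_range_sub fun i : ℕ => ⌊(n * p g + i) * (slope (g * BSt n) : ℚ)⌋]
      simp [mul_add]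
    have hat : slope (g * BSa n * BSt n) = slope (g * BSt n) := by
      rw [slope_t, slope_t, slope_a]
    have hca : c (g * BSa n) = c g := by simp only [c, slope_a]
    have hfactor : (if decide ((slope g : ℚ) < 3) = true then 6 else 1) = c g := by
      simp [c]
    simp only [mul_one, Tile.factor, hfactor, hsum]
    simp only [carry, digit, hat, hca, slope_a, p_a]
    ring

end Existence

/-- For every `n ≥ 2` there is a nonempty strongly aperiodic SFT on `BS(1,n)`. -/
theorem exists_strongly_aperiodic_SFT (n : ℕ) (hn : 2 ≤ n) :
    ∃ (R : Type) (_ : Fintype R) (F : Set (Finset (BS n) × (BS n → R))),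
      F.Finite ∧ (XofF F).Nonempty ∧ StronglyAperiodic (XofF F) := by
  have : NeZero n := ⟨by omega⟩
  obtain ⟨F, hF, hX⟩ := exists_finite_XofF_eq (tileWindow n) (TileRule n)
    fun _ _ h hx => hx.congr h
  obtain ⟨x, hx⟩ := exists_isTiling (n := n) (by omega)
  refine ⟨Tile n, Fintype.ofFinite _, F, hF, ⟨x, hX ▸ hx⟩, fun y hy g hg => ?_⟩
  rw [hX] at hy
  exact IsTiling_s16.eq_one_of_period hy hn g (apply_mul_of_shift_eq hg)
end
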